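/- arXiv:2403.03104 — 8 statements merged into one kernel-verified Lean document; each statement's English description precedes it below -/
import Mathlib

section
/- Let n, r be positive integers with r ≤ n, let A be a real n×n matrix, and let U : ℝ → ℝ^{n×r} be a differentiable matrix-valued function satisfying the Oja flow equation U'(t) = (I_n − U(t)U(t)ᵀ) A U(t) for all t ≥ 0. If U(0)ᵀU(0) = I_r, then U(t)ᵀU(t) = I_r for all t ≥ 0 (i.e., the Stiefel manifold St(r,n) is invariant under the Oja flow). -/
open Matrix

/-- Grönwall's inequality in homogeneous form: a curve starting at zero whose velocity is bounded
by a continuous multiple of its norm vanishes identically. -/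
theorem eq_zero_of_hasDerivAt_of_norm_le {F : Type*} [NormedAddCommGroup F] [NormedSpace ℝ F]
    {f f' : ℝ → F} {k : ℝ → ℝ} (hk : ContinuousOn k (Set.Ici 0))
    (hf : ∀ t, 0 ≤ t → HasDerivAt f (f' t) t) (hf' : ∀ t, 0 ≤ t → ‖f' t‖ ≤ k t * ‖f t‖)
    (h0 : f 0 = 0) {t : ℝ} (ht : 0 ≤ t) : f t = 0 := by
  obtain ⟨K, hK⟩ := (isCompact_Icc (a := (0 : ℝ)) (b := t)).bddAbove_image
    (hk.mono Set.Icc_subset_Ici_self)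
  exact eq_zero_of_abs_deriv_le_mul_abs_self_of_eq_zero_right (K := K)
    (fun s hs => (hf s hs.1).continuousAt.continuousWithinAt)
    (fun s hs => (hf s hs.1).hasDerivWithinAt) h0
    (fun s hs => (hf' s hs.1).trans (mul_le_mul_of_nonneg_right
      (hK ⟨s, Set.Ico_subset_Icc_self hs, rfl⟩) (norm_nonneg _)))
    t ⟨ht, le_rfl⟩

section

attribute [local instance] Matrix.linftyOpNormedRing Matrix.linftyOpNormedSpace

/-- A differentiable curve of square matrices solving a homogeneous Lyapunov equation with
continuous coefficients and starting at zero vanishes identically. -/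
theorem Matrix.eq_zero_of_hasDerivAt_lyapunov {m : Type*} [Fintype m] [DecidableEq m]
    {E M N : ℝ → Matrix m m ℝ} (hM : ContinuousOn M (Set.Ici 0)) (hN : ContinuousOn N (Set.Ici 0))
    (hE : ∀ t, 0 ≤ t → ∀ i j, HasDerivAt (fun s => E s i j) ((-(E t * M t + N t * E t)) i j) t)
    (h0 : E 0 = 0) {t : ℝ} (ht : 0 ≤ t) : E t = 0 := by
  refine eq_zero_of_hasDerivAt_of_norm_le (k := fun s => ‖M s‖ + ‖N s‖)
    (f' := fun s => -(E s * M s + N s * E s)) (hM.norm.add hN.norm)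
    (fun s hs => hasDerivAt_pi.2 fun i => hasDerivAt_pi.2 fun j => hE s hs i j)
    (fun s _ => ?_) h0 ht
  calc ‖-(E s * M s + N s * E s)‖ = ‖E s * M s + N s * E s‖ := norm_neg _
    _ ≤ ‖E s‖ * ‖M s‖ + ‖N s‖ * ‖E s‖ :=
      (norm_add_le _ _).trans (add_le_add (norm_mul_le _ _) (norm_mul_le _ _))
    _ = (‖M s‖ + ‖N s‖) * ‖E s‖ := by ring

end

/-- The Leibniz rule, entrywise, for the Gram matrix of a curve of rectangular matrices. -/
theorem Matrix.hasDerivAt_transpose_mul_self_apply {m p : Type*} [Fintype m]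
    {U : ℝ → Matrix m p ℝ} {U' : Matrix m p ℝ} {t : ℝ}
    (hU : ∀ i j, HasDerivAt (fun s => U s i j) (U' i j) t) (i j : p) :
    HasDerivAt (fun s => ((U s)ᵀ * U s) i j) ((U'ᵀ * U t + (U t)ᵀ * U') i j) t := by
  simp only [Matrix.add_apply, Matrix.mul_apply, Matrix.transpose_apply, ← Finset.sum_add_distrib]
  exact HasDerivAt.fun_sum fun l _ => (hU l i).mul (hU l j)

/-- **Invariance of the Stiefel manifold under the Oja flow.**
If `U : ℝ → ℝ^{n×r}` satisfies (entrywise) the Oja flow equation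
`U'(t) = (I_n − U(t)U(t)ᵀ) A U(t)` for all `t ≥ 0` and `U(0)ᵀU(0) = I_r`,
then `U(t)ᵀU(t) = I_r` for all `t ≥ 0`. -/
theorem oja_flow_stiefel_invariant
    {n r : ℕ} (hn : 0 < n) (hr : 0 < r) (hrn : r ≤ n)
    (A : Matrix (Fin n) (Fin n) ℝ)
    (U : ℝ → Matrix (Fin n) (Fin r) ℝ)
    (hode : ∀ t : ℝ, 0 ≤ t → ∀ (i : Fin n) (j : Fin r),
      HasDerivAt (fun s : ℝ => U s i j)
        ((((1 : Matrix (Fin n) (Fin n) ℝ) - U t * (U t)ᵀ) * A * U t) i j) t)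
    (hinit : (U 0)ᵀ * U 0 = (1 : Matrix (Fin r) (Fin r) ℝ)) :
    ∀ t : ℝ, 0 ≤ t → (U t)ᵀ * U t = (1 : Matrix (Fin r) (Fin r) ℝ) := by
  intro t ht
  have hU : ContinuousOn U (Set.Ici 0) := fun s hs =>
    ContinuousAt.continuousWithinAt <| continuousAt_pi.2 fun i => continuousAt_pi.2 fun j =>
      (hode s hs i j).continuousAt
  have hM : ContinuousOn (fun s => (U s)ᵀ * A * U s) (Set.Ici 0) := by
    rw [continuousOn_iff_continuous_domRestrict] at hU ⊢
    exact (hU.matrix_transpose.matrix_mul continuous_const).matrix_mul hU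
  have hMT : ContinuousOn (fun s => ((U s)ᵀ * A * U s)ᵀ) (Set.Ici 0) := by
    rw [continuousOn_iff_continuous_domRestrict] at hM ⊢
    exact hM.matrix_transpose
  refine sub_eq_zero.1 (Matrix.eq_zero_of_hasDerivAt_lyapunov (E := fun s => (U s)ᵀ * U s - 1)
    hM hMT (fun s hs i j => ?_) (by simp [hinit]) ht)
  have hGram := (Matrix.hasDerivAt_transpose_mul_self_apply (hode s hs) i j).sub_const
    ((1 : Matrix (Fin r) (Fin r) ℝ) i j)
  refine hGram.congr_deriv (congrArg (fun B : Matrix (Fin r) (Fin r) ℝ => B i j) ?_)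
  simp only [Matrix.transpose_mul, Matrix.transpose_sub,
    Matrix.transpose_transpose, Matrix.mul_assoc, Matrix.sub_mul, Matrix.mul_sub, Matrix.one_mul,
    Matrix.mul_one]
  abel
end

section
/- Let A ∈ ℝ^{n×n}, let Ψ ∈ ℂ^{n×n} be invertible with Λ = Ψ⁻¹AΨ, and let P ∈ ℂ^{n×n} be a permutation matrix such that PᵀΛP is block diagonal with respect to the splitting r + (n−r), i.e., the off-diagonal r×(n−r) and (n−r)×r blocks of PᵀΛP are zero. Let K_r ∈ ℂ^{r×r} be invertible such that Ū := Ψ P [K_r; O_{(n−r)×r}] satisfies ŪᵈŪ = I_r. Then Ū is an equilibrium point of the Oja flow: (I_n − ŪŪᵈ)AŪ = 0. Moreover, for every unitary W ∈ ℂ^{r×r}, the matrix ŪW is also an equilibrium point: (I_n − (ŪW)(ŪW)ᵈ)A(ŪW) = 0. -/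
open Matrix

/-- If `A U = U C` for some `C` and `U` has orthonormal columns, then `U` is an equilibrium. -/
theorem one_sub_mul_conjTranspose_mul_mul_eq_zero {m k R : Type*} [Fintype m] [DecidableEq m]
    [Fintype k] [DecidableEq k] [Ring R] [StarRing R] {A : Matrix m m R} {U : Matrix m k R}
    {C : Matrix k k R} (hU : Uᴴ * U = 1) (hAU : A * U = U * C) :
    (1 - U * Uᴴ) * A * U = 0 := by
  rw [Matrix.mul_assoc, hAU, Matrix.sub_mul, Matrix.one_mul, Matrix.mul_assoc U,
    ← Matrix.mul_assoc Uᴴ, hU, Matrix.one_mul, sub_self]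

/-- Padding a matrix by zero rows is multiplication by the first columns of the identity. -/
theorem one_submatrix_castLE_mul {n r : ℕ} {k R : Type*} [Semiring R] (hrn : r ≤ n)
    (K : Matrix (Fin r) k R) :
    (1 : Matrix (Fin n) (Fin n) R).submatrix id (Fin.castLE hrn) * K =
      Matrix.of (fun (i : Fin n) (j : k) => if h : (i : ℕ) < r then K ⟨i, h⟩ j else 0) := by
  ext i j
  simp only [Matrix.mul_apply, Matrix.submatrix_apply, id, Matrix.one_apply, ite_mul, one_mul,
    zero_mul, Matrix.of_apply]
  split_ifs with h
  · rw [Finset.sum_eq_single ⟨i, h⟩]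
    · simp
    · intro l _ hl
      refine if_neg fun hil => hl (Fin.ext ?_)
      simp [hil]
    · simp
  · refine Finset.sum_eq_zero fun l _ => if_neg fun hil => h ?_
    rw [hil]
    exact l.isLt

/-- A matrix with vanishing lower left block preserves the span of the first coordinates. -/
theorem mul_one_submatrix_castLE {n r : ℕ} {R : Type*} [Semiring R] (hrn : r ≤ n)
    (B : Matrix (Fin n) (Fin n) R)
    (hB : ∀ i j : Fin n, ¬ (i : ℕ) < r → (j : ℕ) < r → B i j = 0) :
    B * (1 : Matrix (Fin n) (Fin n) R).submatrix id (Fin.castLE hrn) =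
      (1 : Matrix (Fin n) (Fin n) R).submatrix id (Fin.castLE hrn) *
        B.submatrix (Fin.castLE hrn) (Fin.castLE hrn) := by
  rw [one_submatrix_castLE_mul]
  ext i j
  simp only [Matrix.mul_apply, Matrix.submatrix_apply, id, Matrix.one_apply, mul_ite, mul_one,
    mul_zero, Finset.sum_ite_eq', Finset.mem_univ, if_true, Matrix.of_apply]
  split_ifs with h
  · rfl
  · exact hB _ _ h j.isLt

/-- **Proposition 1 (equilibrium points of the Oja flow).**
Let `A ∈ ℝ^{n×n}`, `Ψ ∈ ℂ^{n×n}` invertible with `Λ = Ψ⁻¹AΨ`, and let `P` be a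
permutation matrix such that `PᵀΛP` is block diagonal w.r.t. the splitting
`r + (n−r)`.  If `K_r` is invertible and `Ū = Ψ P [K_r; O]` satisfies
`ŪᴴŪ = I_r`, then `Ū` is an equilibrium point of the Oja flow,
`(I − ŪŪᴴ)AŪ = 0`, and so is `ŪW` for every unitary `W ∈ ℂ^{r×r}`. -/
theorem oja_equilibrium_points
    {n r : ℕ} (hrn : r ≤ n)
    (A : Matrix (Fin n) (Fin n) ℝ)
    (Ψ : Matrix (Fin n) (Fin n) ℂ) (hΨ : IsUnit Ψ)
    (Lam : Matrix (Fin n) (Fin n) ℂ)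
    (hLam : Lam = Ψ⁻¹ * A.map Complex.ofReal * Ψ)
    (σ : Equiv.Perm (Fin n)) (P : Matrix (Fin n) (Fin n) ℂ)
    (hP : P = σ.permMatrix ℂ)
    (hblock : ∀ (i j : Fin n),
      (((i : ℕ) < r ∧ ¬ (j : ℕ) < r) ∨ (¬ (i : ℕ) < r ∧ (j : ℕ) < r)) →
      (Pᵀ * Lam * P) i j = 0)
    (Kr : Matrix (Fin r) (Fin r) ℂ) (hKr : IsUnit Kr)
    (Ubar : Matrix (Fin n) (Fin r) ℂ)
    (hUdef : Ubar = Ψ * P * Matrix.of (fun (i : Fin n) (j : Fin r) =>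
        if h : (i : ℕ) < r then Kr ⟨i, h⟩ j else 0))
    (hU : Ubarᴴ * Ubar = (1 : Matrix (Fin r) (Fin r) ℂ)) :
    ((1 : Matrix (Fin n) (Fin n) ℂ) - Ubar * Ubarᴴ) * A.map Complex.ofReal * Ubar = 0 ∧
    ∀ W : Matrix (Fin r) (Fin r) ℂ, W ∈ Matrix.unitaryGroup (Fin r) ℂ →
      ((1 : Matrix (Fin n) (Fin n) ℂ) - (Ubar * W) * (Ubar * W)ᴴ) * A.map Complex.ofReal
        * (Ubar * W) = 0 := by
  rw [← one_submatrix_castLE_mul hrn] at hUdef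
  set J := (1 : Matrix (Fin n) (Fin n) ℂ).submatrix id (Fin.castLE hrn)
  set A' := A.map Complex.ofReal
  set B := Pᵀ * Lam * P with hBdef
  set B₁ := B.submatrix (Fin.castLE hrn) (Fin.castLE hrn)
  have hBJ : B * J = J * B₁ :=
    mul_one_submatrix_castLE hrn B fun i j hi hj => hblock i j (Or.inr ⟨hi, hj⟩)
  have hPP : P * Pᵀ = 1 := by
    rw [hP, Matrix.transpose_permMatrix, ← Matrix.permMatrix_mul]
    simp
  have hAΨ : A' * Ψ = Ψ * Lam := by
    rw [hLam, ← Matrix.mul_assoc, ← Matrix.mul_assoc,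
      Matrix.mul_nonsing_inv _ ((Matrix.isUnit_iff_isUnit_det _).mp hΨ), Matrix.one_mul]
  have hΨP : A' * (Ψ * P) = Ψ * P * B := by
    calc A' * (Ψ * P) = Ψ * (1 * (Lam * P)) := by
          rw [← Matrix.mul_assoc, hAΨ, Matrix.one_mul, Matrix.mul_assoc]
      _ = Ψ * P * B := by rw [← hPP, hBdef]; simp only [Matrix.mul_assoc]
  have hAU : A' * Ubar = Ubar * (Kr⁻¹ * (B₁ * Kr)) := by
    have hKK : Kr * (Kr⁻¹ * (B₁ * Kr)) = B₁ * Kr := by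
      rw [← Matrix.mul_assoc, Matrix.mul_nonsing_inv _ ((Matrix.isUnit_iff_isUnit_det _).mp hKr),
        Matrix.one_mul]
    calc A' * Ubar = Ψ * P * (B * J * Kr) := by
          rw [hUdef, ← Matrix.mul_assoc, hΨP]; simp only [Matrix.mul_assoc]
      _ = Ubar * (Kr⁻¹ * (B₁ * Kr)) := by
          rw [hBJ, hUdef]; simp only [Matrix.mul_assoc, hKK]
  have hEq := one_sub_mul_conjTranspose_mul_mul_eq_zero hU hAU
  refine ⟨hEq, fun W hW => ?_⟩
  have hWW : W * Wᴴ = 1 := Matrix.mem_unitaryGroup_iff.mp hW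
  have hproj : Ubar * W * (Ubar * W)ᴴ = Ubar * Ubarᴴ := by
    rw [Matrix.conjTranspose_mul, Matrix.mul_assoc, ← Matrix.mul_assoc W, hWW, Matrix.one_mul]
  rw [hproj, ← Matrix.mul_assoc, hEq, Matrix.zero_mul]
end

section
/- Let B ∈ ℂ^{m×m} and M ∈ ℂ^{r×r} be such that the maximum of the real parts of the eigenvalues of B is strictly less than the minimum of the real parts of the eigenvalues of M. Then every solution X : [0,∞) → ℂ^{m×r} of the linear matrix differential equation X'(t) = B X(t) − X(t) M converges to the zero matrix as t → ∞. -/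
open Matrix Filter

/-- Variation of constants: a forced scalar-stable equation with vanishing forcing
has only solutions tending to zero. -/
theorem tendsto_zero_of_hasDerivAt_smul_add {E : Type*} [NormedAddCommGroup E] [NormedSpace ℂ E]
    {a : ℂ} (ha : a.re < 0) {f g : ℝ → E}
    (hf : ∀ t, 0 ≤ t → HasDerivAt f (a • f t + g t) t) (hg : Tendsto g atTop (nhds 0)) :
    Tendsto f atTop (nhds 0) := by
  have hd : ∀ t : ℝ, 0 ≤ t →
      HasDerivAt (fun s : ℝ => Complex.exp (-a * s) • f s) (Complex.exp (-a * t) • g t) t := by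
    intro t ht
    have h1 : HasDerivAt (fun s : ℝ => Complex.exp (-a * s)) (Complex.exp (-a * t) * (-a)) t := by
      have h2 : HasDerivAt (fun s : ℝ => -a * (s : ℂ)) (-a) t := by
        simpa using (Complex.ofRealCLM.hasDerivAt (x := t)).const_mul (-a)
      exact h2.cexp
    refine (h1.smul (hf t ht)).congr_deriv ?_
    module
  have hn : ∀ t : ℝ, ‖Complex.exp (-a * t)‖ = Real.exp (-a.re * t) := by
    intro t; simp [Complex.norm_exp]
  rw [NormedAddGroup.tendsto_nhds_zero]
  intro ε hε
  have hc : 0 < -a.re := by linarith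
  obtain ⟨T₀, hT₀⟩ := eventually_atTop.1
    (NormedAddGroup.tendsto_nhds_zero.1 hg (-a.re * (ε / 2)) (by positivity))
  set T := max T₀ 0
  have hT : 0 ≤ T := le_max_right _ _
  have hB : ∀ x : ℝ, HasDerivAt (fun s : ℝ => ‖Complex.exp (-a * T) • f T‖ +
      ε / 2 * (Real.exp (-a.re * s) - Real.exp (-a.re * T)))
      (-a.re * (ε / 2) * Real.exp (-a.re * x)) x := by
    intro x
    have h2 : HasDerivAt (fun s : ℝ => -a.re * s) (-a.re) x := by
      simpa using (hasDerivAt_id x).const_mul (-a.re)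
    refine (((h2.exp.sub_const _).const_mul (ε / 2)).const_add _).congr_deriv ?_
    ring
  have hbound : ∀ t, T ≤ t → ‖Complex.exp (-a * t) • f t‖ ≤ ‖Complex.exp (-a * T) • f T‖ +
      ε / 2 * (Real.exp (-a.re * t) - Real.exp (-a.re * T)) := by
    intro t ht
    refine image_norm_le_of_norm_deriv_right_le_deriv_boundary
      (f := fun s : ℝ => Complex.exp (-a * s) • f s)
      (fun s hs => (hd s (hT.trans hs.1)).continuousAt.continuousWithinAt)
      (fun s hs => (hd s (hT.trans hs.1)).hasDerivWithinAt) ?_ hB ?_ ⟨ht, le_rfl⟩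
    · simp
    · intro s hs
      rw [norm_smul, hn, mul_comm]
      have := hT₀ s ((le_max_left _ _).trans hs.1)
      gcongr
  have hlim : Tendsto (fun t : ℝ => Real.exp (a.re * t) * ‖Complex.exp (-a * T) • f T‖)
      atTop (nhds 0) := by
    have : Tendsto (fun t : ℝ => a.re * t) atTop atBot :=
      tendsto_id.const_mul_atTop_of_neg ha
    simpa using (Real.tendsto_exp_atBot.comp this).mul_const ‖Complex.exp (-a * T) • f T‖
  filter_upwards [hlim.eventually (gt_mem_nhds (half_pos hε)), eventually_ge_atTop T] with t h1 h2
  have h3 := hbound t h2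
  rw [norm_smul, hn] at h3
  have h4 : Real.exp (a.re * t) * Real.exp (-a.re * t) = 1 := by
    rw [← Real.exp_add]; simp
  have h5 := Real.exp_pos (a.re * t)
  have h6 := Real.exp_pos (-a.re * T)
  calc ‖f t‖ = Real.exp (a.re * t) * (Real.exp (-a.re * t) * ‖f t‖) := by
        rw [← mul_assoc, h4, one_mul]
    _ ≤ Real.exp (a.re * t) * (‖Complex.exp (-a * T) • f T‖ +
      ε / 2 * (Real.exp (-a.re * t) - Real.exp (-a.re * T))) := by gcongr
    _ = Real.exp (a.re * t) * ‖Complex.exp (-a * T) • f T‖ + ε / 2 * 1 -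
        ε / 2 * (Real.exp (a.re * t) * Real.exp (-a.re * T)) := by rw [← h4]; ring
    _ < ε := by
      have : 0 < ε / 2 * (Real.exp (a.re * t) * Real.exp (-a.re * T)) := by positivity
      linarith

/-- If the image of a solution of `f' = L f` under a polynomial in `L` whose roots have negative
real part tends to zero, so does the solution. -/
theorem tendsto_zero_of_tendsto_aeval_prod {E : Type*} [NormedAddCommGroup E] [NormedSpace ℂ E]
    [FiniteDimensional ℂ E] (L : Module.End ℂ E) (s : Multiset ℂ) (hs : ∀ a ∈ s, a.re < 0)
    (f : ℝ → E) (hf : ∀ t, 0 ≤ t → HasDerivAt f (L (f t)) t)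
    (h : Tendsto (fun t => Polynomial.aeval L
      (s.map fun a => Polynomial.X - Polynomial.C a).prod (f t)) atTop (nhds 0)) :
    Tendsto f atTop (nhds 0) := by
  induction s using Multiset.induction_on generalizing f with
  | empty => simpa using h
  | cons a s ih =>
    refine tendsto_zero_of_hasDerivAt_smul_add (hs a (by simp))
      (g := fun t => L (f t) - a • f t) (fun t ht => by simpa using hf t ht) ?_
    refine ih (fun b hb => hs b (by simp [hb])) _ (fun t ht => ?_) ?_
    · have h_comp := ((LinearMap.toContinuousLinearMap L).restrictScalars ℝ).hasFDerivAt
        (x := f t) |>.comp_hasDerivAt t (hf t ht)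
      exact (h_comp.sub ((hf t ht).const_smul a)).congr_deriv (by simp)
    · refine h.congr fun t => ?_
      rw [Multiset.map_cons, Multiset.prod_cons, mul_comm, map_mul]
      simp [Module.algebraMap_end_apply]

/-- A linear flow on a finite-dimensional complex space whose generator has only eigenvalues of
negative real part is asymptotically stable. -/
theorem tendsto_zero_of_hasEigenvalue_re_neg {E : Type*} [NormedAddCommGroup E] [NormedSpace ℂ E]
    [FiniteDimensional ℂ E] (L : Module.End ℂ E) (hL : ∀ a, L.HasEigenvalue a → a.re < 0)
    (f : ℝ → E) (hf : ∀ t, 0 ≤ t → HasDerivAt f (L (f t)) t) :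
    Tendsto f atTop (nhds 0) := by
  refine tendsto_zero_of_tendsto_aeval_prod L (minpoly ℂ L).roots (fun a ha => ?_) f hf ?_
  · exact hL a (Module.End.hasEigenvalue_of_isRoot (Polynomial.isRoot_of_mem_roots ha))
  · have hp := (IsAlgClosed.splits (minpoly ℂ L)).eq_prod_roots_of_monic
      (minpoly.monic (Algebra.IsIntegral.isIntegral L))
    rw [← hp, minpoly.aeval]
    simp

/-- The Sylvester operator `X ↦ B X - X M`. -/
def sylvesterMap {m r : ℕ} (B : Matrix (Fin m) (Fin m) ℂ) (M : Matrix (Fin r) (Fin r) ℂ) :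
    Module.End ℂ (Matrix (Fin m) (Fin r) ℂ) :=
  mulLeftLinearMap (Fin r) ℂ B - mulRightLinearMap (Fin m) ℂ M

/-- Each eigenvalue of the Sylvester operator is a difference of eigenvalues of `B` and `M`. -/
theorem exists_eq_sub_of_hasEigenvalue_sylvesterMap {m r : ℕ} {B : Matrix (Fin m) (Fin m) ℂ}
    {M : Matrix (Fin r) (Fin r) ℂ} {a : ℂ} (ha : (sylvesterMap B M).HasEigenvalue a) :
    ∃ μ ∈ spectrum ℂ B, ∃ ν ∈ spectrum ℂ M, a = μ - ν := by
  have hinv : ∀ Y ∈ (sylvesterMap B M).eigenspace a,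
      mulLeftLinearMap (Fin r) ℂ B Y ∈ (sylvesterMap B M).eigenspace a := by
    intro Y hY
    rw [Module.End.mem_eigenspace_iff] at hY ⊢
    have : B * Y - Y * M = a • Y := hY
    change B * (B * Y) - B * Y * M = a • (B * Y)
    rw [Matrix.mul_assoc, ← Matrix.mul_sub, this, Matrix.mul_smul]
  have : Nontrivial ((sylvesterMap B M).eigenspace a) := Submodule.nontrivial_iff_ne_bot.2 ha
  obtain ⟨μ, hμ⟩ := Module.End.exists_eigenvalue
    ((mulLeftLinearMap (Fin r) ℂ B).restrict hinv)
  obtain ⟨⟨Y, hY⟩, hv⟩ := hμ.exists_hasEigenvector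
  have hY0 : Y ≠ 0 := fun h => hv.2 (Subtype.ext h)
  have hB : B * Y = μ • Y := congrArg Subtype.val hv.apply_eq_smul
  have hS : B * Y - Y * M = a • Y := Module.End.mem_eigenspace_iff.1 hY
  refine ⟨μ, fun hu => hY0 ?_, μ - a, fun hu => hY0 ?_, by ring⟩
  · obtain ⟨C, hC⟩ := hu.exists_left_inv
    rw [← Matrix.one_mul Y, ← hC, Matrix.mul_assoc, Matrix.sub_mul, hB]
    simp [Algebra.algebraMap_eq_smul_one]
  · obtain ⟨C, hC⟩ := hu.exists_right_inv
    have hM : Y * M = (μ - a) • Y := by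
      rw [sub_smul, ← hS, ← hB]; abel
    rw [← Matrix.mul_one Y, ← hC, ← Matrix.mul_assoc, Matrix.mul_sub, hM]
    simp [Algebra.algebraMap_eq_smul_one]

/-- **Stability of the linearized (Sylvester) dynamics.**
If every eigenvalue of `B` has real part strictly smaller than the real part
of every eigenvalue of `M`, then every solution of `X' = BX − XM` on `[0,∞)`
converges to the zero matrix as `t → ∞`. -/
theorem sylvester_flow_stable
    {m r : ℕ}
    (B : Matrix (Fin m) (Fin m) ℂ) (M : Matrix (Fin r) (Fin r) ℂ)
    (hspec : ∀ μ ∈ spectrum ℂ B, ∀ ν ∈ spectrum ℂ M, μ.re < ν.re)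
    (X : ℝ → Matrix (Fin m) (Fin r) ℂ)
    (hode : ∀ t : ℝ, 0 ≤ t → ∀ (i : Fin m) (j : Fin r),
      HasDerivAt (fun s : ℝ => X s i j) ((B * X t - X t * M) i j) t) :
    Tendsto X atTop (nhds 0) := by
  let _ : NormedAddCommGroup (Matrix (Fin m) (Fin r) ℂ) := Matrix.normedAddCommGroup
  let _ : NormedSpace ℂ (Matrix (Fin m) (Fin r) ℂ) := Matrix.normedSpace
  refine tendsto_zero_of_hasEigenvalue_re_neg (sylvesterMap B M) (fun a ha => ?_) X
    fun t ht => hasDerivAt_pi.2 fun i => hasDerivAt_pi.2 fun j => hode t ht i j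
  obtain ⟨μ, hμ, ν, hν, rfl⟩ := exists_eq_sub_of_hasEigenvalue_sylvesterMap ha
  simpa using hspec μ hμ ν hν
end

section
/- Let A ∈ ℝ^{2×2} have two distinct real eigenvalues λ₁ > λ₂ with corresponding unit eigenvectors ψ₁ and ψ₂. Let u : [0,∞) → ℝ² be a solution of the Oja flow u'(t) = (I₂ − u(t)u(t)ᵀ) A u(t) with ‖u(0)‖ = 1 and u(0) not a scalar multiple of ψ₂. Then u(t) converges as t → ∞ to ψ₁ or to −ψ₁. -/
open Matrix Filter

/-- An integrating factor for a coefficient which is continuous on `[0, ∞)`. -/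
lemma exists_integratingFactor {q : ℝ → ℝ} (hq : ContinuousOn q (Set.Ici 0)) :
    ∃ E : ℝ → ℝ, E 0 = 1 ∧ (∀ t, 0 < E t) ∧ ∀ t, 0 ≤ t → HasDerivAt E (q t * E t) t := by
  have hc : Continuous fun s : ℝ => q (max s 0) :=
    hq.comp_continuous (by fun_prop) fun s => le_max_right s 0
  refine ⟨fun t => Real.exp (∫ s in (0 : ℝ)..t, q (max s 0)), by simp,
    fun t => Real.exp_pos _, fun t ht => ?_⟩
  have h := (hc.integral_hasStrictDerivAt 0 t).hasDerivAt.exp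
  rw [max_eq_left ht] at h
  simpa only [mul_comm] using h

/-- The solution of a scalar linear equation in terms of an integrating factor. -/
lemma mul_integratingFactor_eq {q E y : ℝ → ℝ} {k : ℝ} (hE0 : E 0 = 1)
    (hE : ∀ t, 0 ≤ t → HasDerivAt E (q t * E t) t)
    (hy : ∀ t, 0 ≤ t → HasDerivAt y ((k - q t) * y t) t) {t : ℝ} (ht : 0 ≤ t) :
    y t * E t = y 0 * Real.exp (k * t) := by
  have hd : ∀ s, 0 ≤ s →
      HasDerivAt (fun s => y s * E s * Real.exp (-(k * s))) 0 s := fun s hs => by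
    have he : HasDerivAt (fun s : ℝ => Real.exp (-(k * s))) (Real.exp (-(k * s)) * -(k * 1)) s :=
      ((hasDerivAt_id s).const_mul k).neg.exp
    convert! ((hy s hs).mul (hE s hs)).mul he using 1
    simp only [Pi.mul_apply]
    ring
  have hconst := constant_of_has_deriv_right_zero (a := 0) (b := t)
    (fun s hs => (hd s hs.1).continuousAt.continuousWithinAt)
    (fun s hs => (hd s hs.1).hasDerivWithinAt) t ⟨ht, le_rfl⟩
  simp only [hE0, mul_zero, neg_zero, Real.exp_zero, mul_one, Real.exp_neg] at hconst
  field_simp at hconst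
  linarith

/-- A curve of unit vectors which are positive multiples of `v t` converges to the unit limit of `v`. -/
lemma tendsto_of_pos_smul_of_unit {u v : ℝ → Fin 2 → ℝ} {c : ℝ → ℝ} {ψ : Fin 2 → ℝ}
    (hψ : ψ ⬝ᵥ ψ = 1) (hv : Tendsto v atTop (nhds ψ))
    (hc : ∀ t, 0 ≤ t → 0 < c t) (huv : ∀ t, 0 ≤ t → u t = c t • v t)
    (hu : ∀ t, 0 ≤ t → u t ⬝ᵥ u t = 1) : Tendsto u atTop (nhds ψ) := by
  have hn : Tendsto (fun t => (√(v t ⬝ᵥ v t))⁻¹ • v t) atTop (nhds ((√(ψ ⬝ᵥ ψ))⁻¹ • ψ)) := by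
    have hcont : Continuous fun x : Fin 2 → ℝ => √(x ⬝ᵥ x) := by fun_prop
    exact (((hcont.tendsto ψ).comp hv).inv₀ (by simp [hψ])).smul hv
  rw [hψ, Real.sqrt_one, inv_one, one_smul] at hn
  refine hn.congr' ?_
  filter_upwards [eventually_ge_atTop 0] with t ht
  have h1 := hu t ht
  rw [huv t ht, smul_dotProduct, dotProduct_smul, smul_eq_mul, smul_eq_mul] at h1
  have hct := hc t ht
  have h2 : v t ⬝ᵥ v t = ((c t)⁻¹) ^ 2 := by
    field_simp
    linarith
  rw [h2, Real.sqrt_sq (inv_pos.2 hct).le, inv_inv, huv t ht]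

/-- **Proposition 3 (global behavior for `(n,r) = (2,1)`).**
Let `A ∈ ℝ^{2×2}` have real eigenvalues `λ₁ > λ₂` with unit eigenvectors
`ψ₁, ψ₂`.  Any solution of the Oja flow `u' = (I − uuᵀ)Au` starting on the
unit circle and not collinear with `ψ₂` converges to `ψ₁` or `−ψ₁`. -/
theorem oja_flow_n2r1_convergence
    (A : Matrix (Fin 2) (Fin 2) ℝ)
    (lam1 lam2 : ℝ) (hlam : lam2 < lam1)
    (ψ1 ψ2 : Fin 2 → ℝ)
    (hψ1 : A.mulVec ψ1 = lam1 • ψ1) (hψ2 : A.mulVec ψ2 = lam2 • ψ2)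
    (hψ1unit : ψ1 ⬝ᵥ ψ1 = 1) (hψ2unit : ψ2 ⬝ᵥ ψ2 = 1)
    (u : ℝ → Fin 2 → ℝ)
    (hode : ∀ t : ℝ, 0 ≤ t → ∀ i : Fin 2,
      HasDerivAt (fun s : ℝ => u s i)
        (A.mulVec (u t) i - (u t ⬝ᵥ A.mulVec (u t)) * u t i) t)
    (hinit : u 0 ⬝ᵥ u 0 = 1)
    (hnotψ2 : ¬ ∃ c : ℝ, u 0 = c • ψ2) :
    Tendsto u atTop (nhds ψ1) ∨ Tendsto u atTop (nhds (-ψ1)) := by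
  have hA10 := congrFun hψ1 0
  have hA11 := congrFun hψ1 1
  have hA20 := congrFun hψ2 0
  have hA21 := congrFun hψ2 1
  simp only [mulVec, dotProduct, Fin.sum_univ_two, Pi.smul_apply, smul_eq_mul]
    at hA10 hA11 hA20 hA21
  have hU1 := hψ1unit
  have hU2 := hψ2unit
  simp only [dotProduct, Fin.sum_univ_two] at hU1 hU2
  obtain ⟨D, hD⟩ : ∃ D, D = ψ1 0 * ψ2 1 - ψ1 1 * ψ2 0 := ⟨_, rfl⟩
  have hD0 : D ≠ 0 := by
    rintro rfl
    obtain ⟨k, hk⟩ : ∃ k, k = ψ1 0 * ψ2 0 + ψ1 1 * ψ2 1 := ⟨_, rfl⟩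
    have h0 : ψ2 = k • ψ1 := by
      ext i
      fin_cases i
      · simp only [Pi.smul_apply, smul_eq_mul, Fin.zero_eta]
        linear_combination (-ψ1 0) * hk - (ψ2 0) * hU1 + ψ1 1 * hD
      · simp only [Pi.smul_apply, smul_eq_mul, Fin.mk_one]
        linear_combination (-ψ1 1) * hk - (ψ2 1) * hU1 - ψ1 0 * hD
    have h1 : (lam1 - lam2) • ψ2 = 0 := by
      rw [sub_smul, ← hψ2, h0, mulVec_smul, hψ1, smul_comm, sub_self]
    have h2 := (smul_eq_zero.1 h1).resolve_left (sub_pos.2 hlam).ne'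
    simp [h2] at hψ2unit
  set q : ℝ → ℝ := fun t => u t ⬝ᵥ A.mulVec (u t) with hqdef
  have hucont : ∀ i, ContinuousOn (fun s => u s i) (Set.Ici 0) := fun i s hs =>
    (hode s hs i).continuousAt.continuousWithinAt
  have hq : ContinuousOn q (Set.Ici 0) := by
    have hpi : ContinuousOn u (Set.Ici 0) := continuousOn_pi.2 hucont
    have hcont : Continuous fun x : Fin 2 → ℝ => x ⬝ᵥ A.mulVec x := by fun_prop
    exact hcont.comp_continuousOn hpi
  -- The unit circle is invariant.
  have hunit : ∀ t, 0 ≤ t → u t ⬝ᵥ u t = 1 := fun t ht => by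
    obtain ⟨E, hE0, hEpos, hE⟩ :=
      exists_integratingFactor (q := fun t => 2 * q t) (continuousOn_const.mul hq)
    have hy : ∀ t, 0 ≤ t → HasDerivAt (fun t => u t ⬝ᵥ u t - 1)
        ((0 - 2 * q t) * (u t ⬝ᵥ u t - 1)) t := fun t ht => by
      have h0 := hode t ht 0
      have h1 := hode t ht 1
      simp only [dotProduct, Fin.sum_univ_two, hqdef] at h0 h1 ⊢
      convert! ((h0.mul h0).add (h1.mul h1)).sub_const 1 using 1
      ring
    have h := mul_integratingFactor_eq hE0 hE hy ht
    simp only [hinit, sub_self, zero_mul] at h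
    linarith [(mul_eq_zero.1 h).resolve_right (hEpos t).ne']
  obtain ⟨E, hE0, hEpos, hE⟩ := exists_integratingFactor hq
  -- The coordinates of `u` in the eigenbasis, scaled by `D`.
  set w : ℝ → ℝ := fun t => u t 0 * ψ2 1 - u t 1 * ψ2 0 with hw
  set z : ℝ → ℝ := fun t => ψ1 0 * u t 1 - ψ1 1 * u t 0 with hz
  have hw' : ∀ t, 0 ≤ t → HasDerivAt w ((lam1 - q t) * w t) t := fun t ht => by
    convert! ((hode t ht 0).mul_const (ψ2 1)).sub ((hode t ht 1).mul_const (ψ2 0)) using 1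
    change (lam1 - q t) * w t = (_ - q t * _) * _ - (_ - q t * _) * _
    refine mul_left_cancel₀ hD0 ?_
    simp only [hw, mulVec, dotProduct, Fin.sum_univ_two]
    rw [hD]
    linear_combination
      (-(u t 0 * ψ2 1 - u t 1 * ψ2 0)) * (ψ2 1 * hA10 - ψ2 0 * hA11)
      - (ψ1 0 * u t 1 - ψ1 1 * u t 0) * (ψ2 1 * hA20 - ψ2 0 * hA21)
  have hz' : ∀ t, 0 ≤ t → HasDerivAt z ((lam2 - q t) * z t) t := fun t ht => by
    convert! ((hode t ht 1).const_mul (ψ1 0)).sub ((hode t ht 0).const_mul (ψ1 1)) using 1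
    change (lam2 - q t) * z t = _ * (_ - q t * _) - _ * (_ - q t * _)
    refine mul_left_cancel₀ hD0 ?_
    simp only [hz, mulVec, dotProduct, Fin.sum_univ_two]
    rw [hD]
    linear_combination
      (-(u t 0 * ψ2 1 - u t 1 * ψ2 0)) * (ψ1 0 * hA11 - ψ1 1 * hA10)
      - (ψ1 0 * u t 1 - ψ1 1 * u t 0) * (ψ1 0 * hA21 - ψ1 1 * hA20)
  have hdecomp : ∀ t, D • u t = w t • ψ1 + z t • ψ2 := fun t => by
    ext i
    fin_cases i <;>
    · simp [hw, hz, hD]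
      ring
  have hw0 : w 0 ≠ 0 := fun h => hnotψ2 ⟨z 0 / D, by
    have h1 := hdecomp 0
    rw [h, zero_smul, zero_add] at h1
    rw [div_eq_inv_mul, mul_smul, ← h1, inv_smul_smul₀ hD0]⟩
  set v : ℝ → Fin 2 → ℝ := fun t => ψ1 + (z 0 / w 0 * Real.exp (-((lam1 - lam2) * t))) • ψ2
    with hv
  have hvlim : Tendsto v atTop (nhds ψ1) := by
    have h1 : Tendsto (fun t : ℝ => Real.exp (-((lam1 - lam2) * t))) atTop (nhds 0) :=
      Real.tendsto_exp_neg_atTop_nhds_zero.comp (tendsto_id.const_mul_atTop (sub_pos.2 hlam))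
    simpa using ((h1.const_mul (z 0 / w 0)).smul_const ψ2).const_add ψ1
  have huv : ∀ t, 0 ≤ t → u t = (w 0 / D * (Real.exp (lam1 * t) / E t)) • v t := fun t ht => by
    have hwt := mul_integratingFactor_eq hE0 hE hw' ht
    have hzt := mul_integratingFactor_eq hE0 hE hz' ht
    have hEt := (hEpos t).ne'
    have hexp : Real.exp (lam1 * t) * Real.exp (-((lam1 - lam2) * t)) = Real.exp (lam2 * t) := by
      rw [← Real.exp_add]
      ring_nf
    rw [← hexp] at hzt
    ext i
    have hi := congrFun (hdecomp t) i
    simp only [hv, Pi.smul_apply, Pi.add_apply, smul_eq_mul] at hi ⊢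
    generalize Real.exp (-((lam1 - lam2) * t)) = e at hzt ⊢
    field_simp
    linear_combination E t * hi + ψ1 i * hwt + ψ2 i * hzt
  have hpos : ∀ t, 0 < Real.exp (lam1 * t) / E t := fun t => div_pos (Real.exp_pos _) (hEpos t)
  rcases (div_ne_zero hw0 hD0).lt_or_gt with hneg | hgt
  · refine Or.inr (tendsto_of_pos_smul_of_unit (by simpa using hψ1unit) hvlim.neg
      (fun t _ => mul_pos (neg_pos.2 hneg) (hpos t)) (fun t ht => ?_) hunit)
    rw [huv t ht, neg_mul, neg_smul_neg]
  · exact Or.inl (tendsto_of_pos_smul_of_unit hψ1unit hvlim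
      (fun t _ => mul_pos hgt (hpos t)) huv hunit)
end

section
/- Let A ∈ ℝ^{n×n} and let S ∈ ℂ^{n×n} be unitary such that SᵈAS is block upper triangular: SᵈAS = [[L₁₁, L₁₂],[O, L₂₂]] with L₁₁ ∈ ℂ^{r×r}, L₂₂ ∈ ℂ^{(n−r)×(n−r)}, L₁₂ ∈ ℂ^{r×(n−r)}. Suppose δλ := λ_min(L₁₁ + L₁₁ᵈ) − λ_max(L₂₂ + L₂₂ᵈ) > 0, where λ_min and λ_max denote the smallest and largest eigenvalues of the indicated Hermitian matrices. Let ℓ_max be the largest eigenvalue of L₁₂ᵈL₁₂ and set β = δλ² / (δλ² + 4ℓ_max). Let U : [0,∞) → ℝ^{n×r} be a solution of the Oja flow U'(t) = (I_n − U(t)U(t)ᵀ)AU(t) with U(0)ᵀU(0) = I_r, and write SᵈU(t) = [F₁(t); F₂(t)] with F₁(t) ∈ ℂ^{r×r}, F₂(t) ∈ ℂ^{(n−r)×r}. If F₂(0)ᵈF₂(0) < β·I_r in the Loewner order, then F₂(t) → O as t → ∞; i.e., U(t) converges to the stable equilibrium set of the Oja flow. -/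
open Matrix Filter
open scoped ComplexOrder

/-- Embedding of the first `r` indices. -/
def embTop {n r : ℕ} (h : r ≤ n) : Fin r → Fin n := Fin.castLE h

/-- Embedding of the last `n - r` indices. -/
def embBot {n r : ℕ} : Fin (n - r) → Fin n := fun i => ⟨r + i, by omega⟩

section
theorem Matrix.hasDerivAt_iff {m n : Type*} [Fintype m] [Fintype n] {F : ℝ → Matrix m n ℂ}
    {F' : Matrix m n ℂ} {t : ℝ} :
    HasDerivAt F F' t ↔ ∀ i j, HasDerivAt (fun s => F s i j) (F' i j) t :=
  hasDerivAt_pi.trans (forall_congr' fun _ => hasDerivAt_pi)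

theorem HasDerivAt.matrix_mul {l m n : Type*} [Fintype l] [Fintype m] [Fintype n]
    {F : ℝ → Matrix l m ℂ} {F' : Matrix l m ℂ} {G : ℝ → Matrix m n ℂ} {G' : Matrix m n ℂ}
    {t : ℝ} (hF : HasDerivAt F F' t) (hG : HasDerivAt G G' t) :
    HasDerivAt (fun s => F s * G s) (F' * G t + F t * G') t := by
  rw [Matrix.hasDerivAt_iff] at hF hG ⊢
  intro i k
  simp only [Matrix.mul_apply, Matrix.add_apply, ← Finset.sum_add_distrib]
  exact HasDerivAt.fun_sum fun j _ => (hF i j).mul (hG j k)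

theorem HasDerivAt.const_matrix_mul {l m n : Type*} [Fintype l] [Fintype m] [Fintype n]
    {G : ℝ → Matrix m n ℂ} {G' : Matrix m n ℂ} {t : ℝ} (M : Matrix l m ℂ)
    (hG : HasDerivAt G G' t) : HasDerivAt (fun s => M * G s) (M * G') t := by
  rw [Matrix.hasDerivAt_iff] at hG ⊢
  intro i k
  simp only [Matrix.mul_apply]
  exact HasDerivAt.fun_sum fun j _ => (hG j k).const_mul (M i j)

theorem HasDerivAt.matrix_conjTranspose {m n : Type*} [Fintype m] [Fintype n]
    {F : ℝ → Matrix m n ℂ} {F' : Matrix m n ℂ} {t : ℝ} (hF : HasDerivAt F F' t) :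
    HasDerivAt (fun s => (F s)ᴴ) F'ᴴ t := by
  rw [Matrix.hasDerivAt_iff] at hF ⊢
  exact fun i j => (hF j i).star

open scoped Matrix.Norms.Operator

open NormedSpace in
theorem Matrix.hasDerivAt_exp_smul {n : ℕ} (B : Matrix (Fin n) (Fin n) ℂ) (t : ℝ) :
    HasDerivAt (fun s : ℝ => exp (s • B)) (B * exp (t • B)) t :=
  hasDerivAt_exp_smul_const' B t

/-- Gronwall uniqueness on a half-line with a locally bounded Lipschitz coefficient. -/
theorem Matrix.eq_zero_of_norm_deriv_le {m n : Type*} [Fintype m] [Fintype n]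
    {F F' : ℝ → Matrix m n ℂ} {C : ℝ → ℝ} (hC : ContinuousOn C (Set.Ici 0))
    (hF : ∀ t, 0 ≤ t → HasDerivAt F (F' t) t)
    (h0 : F 0 = 0) (hb : ∀ t, 0 ≤ t → ‖F' t‖ ≤ C t * ‖F t‖) {t : ℝ} (ht : 0 ≤ t) : F t = 0 := by
  obtain ⟨K, hK⟩ := (isCompact_Icc (a := (0 : ℝ)) (b := t)).bddAbove_image
    (hC.mono Set.Icc_subset_Ici_self)
  refine eq_zero_of_abs_deriv_le_mul_abs_self_of_eq_zero_right (f' := F') (K := K)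
    (fun s hs => (hF s hs.1).continuousAt.continuousWithinAt)
    (fun s hs => (hF s hs.1).hasDerivWithinAt) h0 (fun s hs => (hb s hs.1).trans ?_) t ⟨ht, le_rfl⟩
  exact mul_le_mul_of_nonneg_right (hK ⟨s, ⟨hs.1, hs.2.le⟩, rfl⟩) (norm_nonneg _)

/-- The Oja flow preserves orthonormality of the columns. -/
theorem Matrix.oja_conjTranspose_mul_self {m n : Type*} [Fintype m] [Fintype n] [DecidableEq m]
    [DecidableEq n] {B : Matrix m m ℂ} {V : ℝ → Matrix m n ℂ}
    (hV : ∀ t, 0 ≤ t → HasDerivAt V ((1 - V t * (V t)ᴴ) * B * V t) t)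
    (h0 : (V 0)ᴴ * V 0 = 1) {t : ℝ} (ht : 0 ≤ t) : (V t)ᴴ * V t = 1 := by
  set H : ℝ → Matrix n n ℂ := fun s => (V s)ᴴ * B * V s with hH
  have hcV : ContinuousOn V (Set.Ici 0) := fun s hs => (hV s hs).continuousAt.continuousWithinAt
  have hcH : ContinuousOn H (Set.Ici 0) :=
    (by fun_prop : Continuous fun M : Matrix m n ℂ => Mᴴ * B * M).comp_continuousOn hcV
  have hE : ∀ s, 0 ≤ s → HasDerivAt (fun s => 1 - (V s)ᴴ * V s)
      (-((1 - (V s)ᴴ * V s) * H s + (H s)ᴴ * (1 - (V s)ᴴ * V s))) s := by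
    intro s hs
    have h := ((hV s hs).matrix_conjTranspose.matrix_mul (hV s hs)).const_sub 1
    refine HasDerivAt.congr_deriv h ?_
    simp only [hH, conjTranspose_mul, conjTranspose_sub, conjTranspose_one,
      conjTranspose_conjTranspose]
    simp only [Matrix.mul_sub, Matrix.sub_mul, Matrix.one_mul, Matrix.mul_one, Matrix.mul_assoc]
    abel
  have := Matrix.eq_zero_of_norm_deriv_le (C := fun s => ‖H s‖ + ‖(H s)ᴴ‖)
    (hcH.norm.add (continuous_id.matrix_conjTranspose.comp_continuousOn hcH).norm)
    hE (by simp [h0]) (fun s _ => ?_) ht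
  · exact (sub_eq_zero.mp this).symm
  · rw [norm_neg, add_mul]
    refine (norm_add_le _ _).trans (add_le_add ?_ (linfty_opNorm_mul _ _))
    rw [mul_comm ‖H s‖]
    exact linfty_opNorm_mul _ _

open NormedSpace in
/-- The column space of the Oja flow is transported by the linear flow `w' = B w`. -/
theorem Matrix.oja_eq_exp_mul {n : ℕ} {m : Type*} [Fintype m] [DecidableEq m]
    {B : Matrix (Fin n) (Fin n) ℂ} {V : ℝ → Matrix (Fin n) m ℂ}
    (hV : ∀ t, 0 ≤ t → HasDerivAt V ((1 - V t * (V t)ᴴ) * B * V t) t)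
    (h0 : (V 0)ᴴ * V 0 = 1) {t : ℝ} (ht : 0 ≤ t) :
    ∃ C : Matrix m m ℂ, V t = exp (t • B) * (V 0 * C) := by
  set H : ℝ → Matrix m m ℂ := fun s => (V s)ᴴ * B * V s with hH
  have hcV : ContinuousOn V (Set.Ici 0) := fun s hs => (hV s hs).continuousAt.continuousWithinAt
  have hcH : ContinuousOn H (Set.Ici 0) :=
    (by fun_prop : Continuous fun M : Matrix (Fin n) m ℂ => Mᴴ * B * M).comp_continuousOn hcV
  set Z : ℝ → Matrix (Fin n) m ℂ := fun s => exp (s • (-B)) * V s with hZdef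
  have hZ : ∀ s, 0 ≤ s → HasDerivAt Z (-(Z s * H s)) s := by
    intro s hs
    refine HasDerivAt.congr_deriv
      ((Matrix.hasDerivAt_exp_smul (-B) s).matrix_mul (hV s hs)) ?_
    have hc : -B * exp (s • (-B)) = exp (s • (-B)) * -B :=
      (((Commute.refl (-B)).smul_right s).exp_right).eq
    rw [hc]
    simp only [hH, hZdef, Matrix.mul_assoc, Matrix.mul_sub, Matrix.sub_mul, Matrix.one_mul,
      Matrix.mul_neg, Matrix.neg_mul]
    abel
  have hK : ∀ s, 0 ≤ s → HasDerivAt (fun s => (1 - V 0 * (V 0)ᴴ) * Z s)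
      (-((1 - V 0 * (V 0)ᴴ) * Z s * H s)) s := by
    intro s hs
    refine HasDerivAt.congr_deriv ((hZ s hs).const_matrix_mul (1 - V 0 * (V 0)ᴴ)) ?_
    simp [Matrix.mul_assoc]
  have key := Matrix.eq_zero_of_norm_deriv_le (C := fun s => ‖H s‖) hcH.norm hK
    (by simp [hZdef, Matrix.sub_mul, Matrix.mul_assoc, h0]) (fun s _ => by
      rw [norm_neg, mul_comm]; exact linfty_opNorm_mul _ _) ht
  refine ⟨(V 0)ᴴ * Z t, ?_⟩
  rw [Matrix.sub_mul, Matrix.one_mul, sub_eq_zero, Matrix.mul_assoc] at key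
  have hexp : exp (t • B) * exp (t • -B) = 1 := by
    rw [← Matrix.exp_add_of_commute _ _ (((Commute.refl B).neg_right.smul_right t).smul_left t)]
    simp
  rw [← key, hZdef, ← Matrix.mul_assoc, hexp, Matrix.one_mul]
end

theorem Matrix.IsHermitian.mul_re_le_of_spectrum {n : Type*} [Fintype n] [DecidableEq n]
    {M : Matrix n n ℂ} (hM : M.IsHermitian) {c : ℝ}
    (h : ∀ x : ℝ, (x : ℂ) ∈ spectrum ℂ M → c ≤ x) (v : n → ℂ) :
    c * (star v ⬝ᵥ v).re ≤ (star v ⬝ᵥ M *ᵥ v).re := by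
  have hH : (M - (c : ℂ) • (1 : Matrix n n ℂ)).IsHermitian :=
    hM.sub (by simp [Matrix.IsHermitian, conjTranspose_smul])
  have hps : (M - (c : ℂ) • (1 : Matrix n n ℂ)).PosSemidef := by
    rw [hH.posSemidef_iff_eigenvalues_nonneg]
    intro i
    have h1 := spectrum.algebraMap_mem ℂ (hH.eigenvalues_mem_spectrum_real i)
    conv at h1 =>
      arg 1
      rw [← Algebra.algebraMap_eq_smul_one, ← spectrum.sub_singleton_eq]
    obtain ⟨z, hz, w, hw, hzw⟩ := h1
    rw [Set.mem_singleton_iff] at hw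
    subst hw
    have hz' : z = ((hH.eigenvalues i + c : ℝ) : ℂ) := by
      rw [sub_eq_iff_eq_add] at hzw
      simpa using hzw
    have := h _ (hz' ▸ hz)
    simp only [Pi.zero_apply]
    linarith
  have := (Complex.le_def.mp (hps.dotProduct_mulVec_nonneg v)).1
  simp only [sub_mulVec, smul_mulVec, one_mulVec, dotProduct_sub, dotProduct_smul, smul_eq_mul,
    Complex.sub_re, Complex.re_ofReal_mul, Complex.zero_re] at this
  linarith

theorem Matrix.IsHermitian.re_le_mul_of_spectrum {n : Type*} [Fintype n] [DecidableEq n]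
    {M : Matrix n n ℂ} (hM : M.IsHermitian) {c : ℝ}
    (h : ∀ x : ℝ, (x : ℂ) ∈ spectrum ℂ M → x ≤ c) (v : n → ℂ) :
    (star v ⬝ᵥ M *ᵥ v).re ≤ c * (star v ⬝ᵥ v).re := by
  have := hM.neg.mul_re_le_of_spectrum (c := -c) (fun x hx => ?_) v
  · simp only [neg_mulVec, dotProduct_neg, Complex.neg_re] at this
    linarith
  · rw [← spectrum.neg_eq, Set.mem_neg] at hx
    have := h (-x) (by simpa using hx)
    linarith

theorem Matrix.PosDef.exists_mul_re_le {n : Type*} [Fintype n] [DecidableEq n]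
    {M : Matrix n n ℂ} (hM : M.PosDef) :
    ∃ ε : ℝ, 0 < ε ∧ ∀ v : n → ℂ, ε * (star v ⬝ᵥ v).re ≤ (star v ⬝ᵥ M *ᵥ v).re := by
  obtain ⟨ε, hε, h⟩ : ∃ ε : ℝ, 0 < ε ∧ ∀ i, ε ≤ hM.isHermitian.eigenvalues i := by
    cases isEmpty_or_nonempty n
    · exact ⟨1, one_pos, fun i => isEmptyElim i⟩
    · obtain ⟨i, hi⟩ := Finite.exists_min hM.isHermitian.eigenvalues
      exact ⟨_, hM.eigenvalues_pos i, hi⟩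
  refine ⟨ε, hε, hM.isHermitian.mul_re_le_of_spectrum fun x hx => ?_⟩
  rw [hM.isHermitian.spectrum_eq_image_range] at hx
  obtain ⟨_, ⟨i, rfl⟩, hi⟩ := hx
  have : hM.isHermitian.eigenvalues i = x := by simpa using hi
  exact this ▸ h i

theorem hasDerivAt_re_star_dotProduct {n : Type*} [Fintype n] {x x' : ℝ → n → ℂ} {t : ℝ}
    (hx : ∀ i, HasDerivAt (fun s => x s i) (x' t i) t) :
    HasDerivAt (fun s => (star (x s) ⬝ᵥ x s).re) (2 * (star (x t) ⬝ᵥ x' t).re) t := by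
  have h : HasDerivAt (fun s => star (x s) ⬝ᵥ x s)
      (star (x' t) ⬝ᵥ x t + star (x t) ⬝ᵥ x' t) t := by
    simp only [dotProduct, ← Finset.sum_add_distrib]
    exact HasDerivAt.fun_sum fun i _ => (hx i).star.mul (hx i)
  refine HasDerivAt.congr_deriv (Complex.reCLM.hasFDerivAt.comp_hasDerivAt t h) ?_
  have : star (x' t) ⬝ᵥ x t = star (star (x t) ⬝ᵥ x' t) := star_dotProduct _ _
  rw [Complex.reCLM_apply, Complex.add_re, this]
  simp [two_mul]

/-- If `a' ≥ l1 a - (δ/2 a + 2l/δ b)` and `b' ≤ l2 b` with `δ = l1 - l2 > 0`, then a ratio `b / a`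
that is initially below the threshold `δ² / (4l)` decays exponentially. -/
theorem ratio_decay {a b a' b' : ℝ → ℝ} {l1 l2 l k : ℝ} (hgap : l2 < l1) (hl : 0 ≤ l)
    (hk0 : 0 ≤ k) (hk : 4 * l * k < (l1 - l2) ^ 2) (ha0 : ∀ t, 0 ≤ a t)
    (ha : ∀ t, HasDerivAt a (a' t) t) (hb : ∀ t, HasDerivAt b (b' t) t)
    (ha' : ∀ t, l1 * a t - ((l1 - l2) / 2 * a t + l / ((l1 - l2) / 2) * b t) ≤ a' t)
    (hb' : ∀ t, b' t ≤ l2 * b t)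
    (h0 : b 0 ≤ k * a 0) {t : ℝ} (ht : 0 ≤ t) :
    b t ≤ k * Real.exp (-(((l1 - l2) ^ 2 - 4 * l * k) / (2 * (l1 - l2)) * t)) * a t := by
  set δ := l1 - l2 with hδ
  have hδ0 : 0 < δ := by linarith
  set μ := (δ ^ 2 - 4 * l * k) / (2 * δ) with hμ
  have hμ0 : 0 < μ := by rw [hμ]; apply div_pos <;> linarith
  set κ : ℝ → ℝ := fun s => k * Real.exp (-(μ * s)) with hκ
  set M : ℝ → ℝ := fun s => l2 * s - 2 * l / (δ * μ) * κ s with hM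
  set g : ℝ → ℝ := fun s => (κ s * a s - b s) * Real.exp (-M s) with hg
  have hκd : ∀ s, HasDerivAt κ (-μ * κ s) s := by
    intro s
    have := ((((hasDerivAt_id s).const_mul μ).neg).exp).const_mul k
    refine HasDerivAt.congr_deriv this ?_
    simp [hκ]
    ring
  have hMd : ∀ s, HasDerivAt M (l2 + 2 * l / δ * κ s) s := by
    intro s
    refine HasDerivAt.congr_deriv
      (((hasDerivAt_id s).const_mul l2).sub ((hκd s).const_mul (2 * l / (δ * μ)))) ?_
    field_simp
    ring
  have hgd : ∀ s, HasDerivAt g ((-μ * κ s * a s + κ s * a' s - b' s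
      - (l2 + 2 * l / δ * κ s) * (κ s * a s - b s)) * Real.exp (-M s)) s := by
    intro s
    refine HasDerivAt.congr_deriv
      ((((hκd s).mul (ha s)).sub (hb s)).mul (hMd s).neg.exp) ?_
    simp only [Pi.sub_apply, Pi.mul_apply, Pi.neg_apply]
    ring
  have hmono : MonotoneOn g (Set.Ici 0) := by
    refine monotoneOn_of_deriv_nonneg (convex_Ici 0)
      (fun s _ => (hgd s).continuousAt.continuousWithinAt)
      (fun s _ => (hgd s).differentiableAt.differentiableWithinAt) fun s hs => ?_
    rw [interior_Ici, Set.mem_Ioi] at hs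
    rw [(hgd s).deriv]
    refine mul_nonneg ?_ (Real.exp_pos _).le
    have hκ0 : 0 ≤ κ s := mul_nonneg hk0 (Real.exp_pos _).le
    have hκk : κ s ≤ k := mul_le_of_le_one_right hk0
      (Real.exp_le_one_iff.mpr (by nlinarith))
    have e1 := mul_le_mul_of_nonneg_left (ha' s) hκ0
    have e2 := hb' s
    have e3 : 0 ≤ κ s * a s * (2 * l / δ * (k - κ s)) :=
      mul_nonneg (mul_nonneg hκ0 (ha0 s)) (mul_nonneg (by positivity) (by linarith))
    have e4 : δ / 2 - μ - 2 * l / δ * k = 0 := by rw [hμ]; field_simp; ring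
    have e5 : l / (δ / 2) = 2 * l / δ := by field_simp
    have e6 : l1 = l2 + δ := by rw [hδ]; ring
    rw [e5, e6] at e1
    nlinarith [congrArg (fun z => κ s * a s * z) e4]
  have hfin := hmono Set.self_mem_Ici ht ht
  have hg0 : 0 ≤ g 0 := mul_nonneg (by simp [hκ]; exact h0) (Real.exp_pos _).le
  have := nonneg_of_mul_nonneg_left (hg0.trans hfin) (Real.exp_pos _)
  exact sub_nonneg.mp this

theorem sum_embTop_add_sum_embBot {n r : ℕ} (h : r ≤ n) {M : Type*} [AddCommMonoid M]
    (f : Fin n → M) : ∑ i, f i = ∑ i, f (embTop h i) + ∑ i, f (embBot (r := r) i) := by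
  obtain ⟨m, rfl⟩ := Nat.exists_eq_add_of_le h
  rw [Fin.sum_univ_add]
  congr 1
  exact (Fintype.sum_equiv (finCongr (by omega : r + m - r = m)) (fun i => f (embBot i))
    (fun i => f (Fin.natAdd r i)) fun i => rfl).symm

theorem star_dotProduct_self_re_nonneg {n : Type*} [Fintype n] (v : n → ℂ) :
    0 ≤ (star v ⬝ᵥ v).re :=
  (Complex.le_def.mp (dotProduct_star_self_nonneg v)).1.trans_eq (by rw [dotProduct_comm])

theorem star_dotProduct_conjTranspose_mulVec {m n : Type*} [Fintype m] [Fintype n]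
    (L : Matrix m n ℂ) (v : n → ℂ) (w : m → ℂ) : star v ⬝ᵥ Lᴴ *ᵥ w = star (L *ᵥ v) ⬝ᵥ w := by
  rw [star_mulVec, dotProduct_mulVec]

theorem star_dotProduct_conjTranspose_mul_self_mulVec {m n : Type*} [Fintype m] [Fintype n]
    (L : Matrix m n ℂ) (v : n → ℂ) :
    star v ⬝ᵥ (Lᴴ * L) *ᵥ v = star (L *ᵥ v) ⬝ᵥ L *ᵥ v := by
  rw [← mulVec_mulVec, star_dotProduct_conjTranspose_mulVec]

theorem star_dotProduct_add_conjTranspose_mulVec_re {n : Type*} [Fintype n]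
    (L : Matrix n n ℂ) (v : n → ℂ) :
    (star v ⬝ᵥ (L + Lᴴ) *ᵥ v).re = 2 * (star v ⬝ᵥ L *ᵥ v).re := by
  rw [add_mulVec, dotProduct_add, star_dotProduct_conjTranspose_mulVec, star_dotProduct (L *ᵥ v)]
  simp [two_mul]

theorem neg_le_two_mul_star_dotProduct_re {n : Type*} [Fintype n] (u v : n → ℂ) {θ : ℝ}
    (hθ : 0 < θ) :
    -(θ * (star u ⬝ᵥ u).re + (star v ⬝ᵥ v).re / θ) ≤ 2 * (star u ⬝ᵥ v).re := by
  have h := star_dotProduct_self_re_nonneg ((θ : ℂ) • u + v)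
  have hvu : (star v ⬝ᵥ u).re = (star u ⬝ᵥ v).re := by rw [star_dotProduct v]; simp
  simp only [star_add, star_smul, add_dotProduct, dotProduct_add, smul_dotProduct,
    dotProduct_smul, smul_eq_mul, Complex.add_re, RCLike.star_def, Complex.conj_ofReal,
    Complex.re_ofReal_mul, hvu] at h
  have : θ * (θ * (star u ⬝ᵥ u).re + (star v ⬝ᵥ v).re / θ + 2 * (star u ⬝ᵥ v).re) =
      θ * (θ * (star u ⬝ᵥ u).re) + θ * (star u ⬝ᵥ v).re
        + (θ * (star u ⬝ᵥ v).re + (star v ⬝ᵥ v).re) := by field_simp; ring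
  have := nonneg_of_mul_nonneg_right (b := θ * (star u ⬝ᵥ u).re + (star v ⬝ᵥ v).re / θ
    + 2 * (star u ⬝ᵥ v).re) (by linarith) hθ
  linarith

open NormedSpace in
/-- Below the threshold, the linear flow of a block upper triangular matrix contracts the bottom
block relative to the top one. -/
theorem linear_flow_bot_le {n r : ℕ} (hrn : r ≤ n) {B : Matrix (Fin n) (Fin n) ℂ}
    {L11 : Matrix (Fin r) (Fin r) ℂ} {L22 : Matrix (Fin (n - r)) (Fin (n - r)) ℂ}
    {L12 : Matrix (Fin r) (Fin (n - r)) ℂ}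
    (hL11 : L11 = B.submatrix (embTop hrn) (embTop hrn)) (hL22 : L22 = B.submatrix embBot embBot)
    (hL12 : L12 = B.submatrix (embTop hrn) embBot)
    (hblock : ∀ (i : Fin (n - r)) (j : Fin r), B (embBot i) (embTop hrn j) = 0)
    {l1 l2 l k : ℝ} (hgap : l2 < l1) (hl : 0 ≤ l) (hk0 : 0 ≤ k)
    (hk : 4 * l * k < (l1 - l2) ^ 2)
    (h1 : ∀ v, l1 * (star v ⬝ᵥ v).re ≤ (star v ⬝ᵥ (L11 + L11ᴴ) *ᵥ v).re)
    (h2 : ∀ v, (star v ⬝ᵥ (L22 + L22ᴴ) *ᵥ v).re ≤ l2 * (star v ⬝ᵥ v).re)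
    (h12 : ∀ v, (star v ⬝ᵥ (L12ᴴ * L12) *ᵥ v).re ≤ l * (star v ⬝ᵥ v).re)
    (w : Fin n → ℂ)
    (h0 : (star (w ∘ embBot (r := r)) ⬝ᵥ (w ∘ embBot (r := r))).re
      ≤ k * (star (w ∘ embTop hrn) ⬝ᵥ (w ∘ embTop hrn)).re)
    {t : ℝ} (ht : 0 ≤ t) :
    (star ((exp (t • B) *ᵥ w) ∘ embBot (r := r)) ⬝ᵥ ((exp (t • B) *ᵥ w) ∘ embBot (r := r))).re
      ≤ k * Real.exp (-(((l1 - l2) ^ 2 - 4 * l * k) / (2 * (l1 - l2)) * t)) *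
        (star ((exp (t • B) *ᵥ w) ∘ embTop hrn) ⬝ᵥ ((exp (t • B) *ᵥ w) ∘ embTop hrn)).re := by
  set W : ℝ → Fin n → ℂ := fun s => exp (s • B) *ᵥ w with hW
  have hWd : ∀ s i, HasDerivAt (fun s => W s i) ((B *ᵥ W s) i) s := by
    intro s i
    have h := Matrix.hasDerivAt_iff.mp (Matrix.hasDerivAt_exp_smul B s)
    rw [hW, mulVec_mulVec]
    exact HasDerivAt.fun_sum (u := Finset.univ) fun j _ => (h i j).mul_const (w j)
  have htop : ∀ s, (B *ᵥ W s) ∘ embTop hrn =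
      L11 *ᵥ (W s ∘ embTop hrn) + L12 *ᵥ (W s ∘ embBot (r := r)) := by
    intro s
    ext i
    simp [hL11, hL12, mulVec, dotProduct, sum_embTop_add_sum_embBot hrn]
  have hbot : ∀ s, (B *ᵥ W s) ∘ embBot (r := r) = L22 *ᵥ (W s ∘ embBot (r := r)) := by
    intro s
    ext i
    simp [hL22, mulVec, dotProduct, sum_embTop_add_sum_embBot hrn, hblock]
  have ha : ∀ s, HasDerivAt (fun s => (star (W s ∘ embTop hrn) ⬝ᵥ (W s ∘ embTop hrn)).re)
      (2 * (star (W s ∘ embTop hrn) ⬝ᵥ ((B *ᵥ W s) ∘ embTop hrn)).re) s := fun s =>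
    hasDerivAt_re_star_dotProduct (x := fun s => W s ∘ embTop hrn)
      (x' := fun s => (B *ᵥ W s) ∘ embTop hrn) fun i => hWd s _
  have hb : ∀ s, HasDerivAt (fun s => (star (W s ∘ embBot (r := r)) ⬝ᵥ (W s ∘ embBot (r := r))).re)
      (2 * (star (W s ∘ embBot (r := r)) ⬝ᵥ ((B *ᵥ W s) ∘ embBot (r := r))).re) s := fun s =>
    hasDerivAt_re_star_dotProduct (x := fun s => W s ∘ embBot (r := r))
      (x' := fun s => (B *ᵥ W s) ∘ embBot (r := r)) fun i => hWd s _
  refine ratio_decay hgap hl hk0 hk (fun s => star_dotProduct_self_re_nonneg _) ha hb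
    (fun s => ?_) (fun s => ?_) (by simpa [hW] using h0) ht
  · have hθ : 0 < (l1 - l2) / 2 := by linarith
    have e1 := h1 (W s ∘ embTop hrn)
    have e2 := neg_le_two_mul_star_dotProduct_re (W s ∘ embTop hrn)
      (L12 *ᵥ (W s ∘ embBot (r := r))) hθ
    have e3 := div_le_div_of_nonneg_right (h12 (W s ∘ embBot (r := r))) hθ.le
    rw [star_dotProduct_conjTranspose_mul_self_mulVec, mul_div_right_comm] at e3
    rw [star_dotProduct_add_conjTranspose_mulVec_re] at e1
    rw [htop, dotProduct_add, Complex.add_re]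
    linarith
  · rw [hbot, ← star_dotProduct_add_conjTranspose_mulVec_re]
    exact h2 _

theorem star_dotProduct_self_re_eq_sum {n : Type*} [Fintype n] (v : n → ℂ) :
    (star v ⬝ᵥ v).re = ∑ i, ‖v i‖ ^ 2 := by
  simp only [dotProduct, Complex.re_sum]
  exact Finset.sum_congr rfl fun i _ => by
    rw [Pi.star_apply, RCLike.star_def, Complex.conj_mul', ← Complex.ofReal_pow, Complex.ofReal_re]

theorem star_dotProduct_self_re_eq_add {n r : ℕ} (hrn : r ≤ n) (v : Fin n → ℂ) :
    (star v ⬝ᵥ v).re = (star (v ∘ embTop hrn) ⬝ᵥ (v ∘ embTop hrn)).re +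
      (star (v ∘ embBot (r := r)) ⬝ᵥ (v ∘ embBot (r := r))).re := by
  simp only [star_dotProduct_self_re_eq_sum, sum_embTop_add_sum_embBot hrn, Function.comp_apply]

theorem star_mulVec_dotProduct_mulVec_of_isometry {m n : Type*} [Fintype m] [Fintype n]
    [DecidableEq n] {V : Matrix m n ℂ} (hV : Vᴴ * V = 1) (v : n → ℂ) :
    star (V *ᵥ v) ⬝ᵥ V *ᵥ v = star v ⬝ᵥ v := by
  rw [← star_dotProduct_conjTranspose_mul_self_mulVec, hV, one_mulVec]

theorem map_ofReal_mul {l m n : Type*} [Fintype m] (M : Matrix l m ℝ) (N : Matrix m n ℝ) :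
    (M * N).map Complex.ofReal = M.map Complex.ofReal * N.map Complex.ofReal :=
  Matrix.map_mul (f := Complex.ofRealHom)

theorem map_ofReal_transpose {m n : Type*} (M : Matrix m n ℝ) :
    Mᵀ.map Complex.ofReal = (M.map Complex.ofReal)ᴴ := by
  ext i j
  simp

/-- A unitary change of basis turns a real Oja flow into a complex Oja flow. -/
theorem hasDerivAt_unitary_oja {n m : Type*} [Fintype n] [DecidableEq n] [Fintype m]
    {A : Matrix n n ℝ} {S : Matrix n n ℂ} (hS : S * Sᴴ = 1) {U : ℝ → Matrix n m ℝ} {t : ℝ}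
    (hode : ∀ i j, HasDerivAt (fun s : ℝ => U s i j)
        ((((1 : Matrix n n ℝ) - U t * (U t)ᵀ) * A * U t) i j) t) :
    HasDerivAt (fun s => Sᴴ * (U s).map Complex.ofReal)
      ((1 - Sᴴ * (U t).map Complex.ofReal * (Sᴴ * (U t).map Complex.ofReal)ᴴ) *
        (Sᴴ * A.map Complex.ofReal * S) * (Sᴴ * (U t).map Complex.ofReal)) t := by
  have hU : HasDerivAt (fun s => (U s).map Complex.ofReal)
      ((((1 : Matrix n n ℝ) - U t * (U t)ᵀ) * A * U t).map Complex.ofReal) t :=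
    Matrix.hasDerivAt_iff.mpr fun i j => (hode i j).ofReal_comp
  convert hU.const_matrix_mul Sᴴ using 1
  have hS' : ∀ M : Matrix n m ℂ, S * (Sᴴ * M) = M := fun M => by
    rw [← Matrix.mul_assoc, hS, Matrix.one_mul]
  have hmap : ∀ M N : Matrix n m ℝ, (M - N).map Complex.ofReal =
      M.map Complex.ofReal - N.map Complex.ofReal := Matrix.map_sub _ Complex.ofReal_sub
  simp only [map_ofReal_mul, hmap, map_ofReal_transpose, conjTranspose_mul,
    conjTranspose_conjTranspose, Matrix.sub_mul, Matrix.mul_sub, Matrix.one_mul,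
    Matrix.mul_assoc, hS']

open NormedSpace in
/-- Exponential decay of the bottom block of the Oja flow of a block upper triangular matrix. -/
theorem oja_bot_norm_sq_le {n r : ℕ} (hrn : r ≤ n) {B : Matrix (Fin n) (Fin n) ℂ}
    {L11 : Matrix (Fin r) (Fin r) ℂ} {L22 : Matrix (Fin (n - r)) (Fin (n - r)) ℂ}
    {L12 : Matrix (Fin r) (Fin (n - r)) ℂ}
    (hL11 : L11 = B.submatrix (embTop hrn) (embTop hrn)) (hL22 : L22 = B.submatrix embBot embBot)
    (hL12 : L12 = B.submatrix (embTop hrn) embBot)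
    (hblock : ∀ (i : Fin (n - r)) (j : Fin r), B (embBot i) (embTop hrn j) = 0)
    {l1 l2 l k : ℝ} (hgap : l2 < l1) (hl : 0 ≤ l) (hk0 : 0 ≤ k)
    (hk : 4 * l * k < (l1 - l2) ^ 2)
    (h1 : ∀ v, l1 * (star v ⬝ᵥ v).re ≤ (star v ⬝ᵥ (L11 + L11ᴴ) *ᵥ v).re)
    (h2 : ∀ v, (star v ⬝ᵥ (L22 + L22ᴴ) *ᵥ v).re ≤ l2 * (star v ⬝ᵥ v).re)
    (h12 : ∀ v, (star v ⬝ᵥ (L12ᴴ * L12) *ᵥ v).re ≤ l * (star v ⬝ᵥ v).re)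
    {V : ℝ → Matrix (Fin n) (Fin r) ℂ}
    (hV : ∀ t, 0 ≤ t → HasDerivAt V ((1 - V t * (V t)ᴴ) * B * V t) t)
    (hV0 : (V 0)ᴴ * V 0 = 1)
    (h0 : ∀ v, (star ((V 0 *ᵥ v) ∘ embBot (r := r)) ⬝ᵥ ((V 0 *ᵥ v) ∘ embBot (r := r))).re
      ≤ k * (star ((V 0 *ᵥ v) ∘ embTop hrn) ⬝ᵥ ((V 0 *ᵥ v) ∘ embTop hrn)).re)
    {t : ℝ} (ht : 0 ≤ t) (i : Fin (n - r)) (j : Fin r) :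
    ‖V t (embBot i) j‖ ^ 2
      ≤ k * Real.exp (-(((l1 - l2) ^ 2 - 4 * l * k) / (2 * (l1 - l2)) * t)) := by
  obtain ⟨C, hC⟩ := Matrix.oja_eq_exp_mul hV hV0 ht
  set c : Fin r → ℂ := Pi.single j 1 with hc
  have hw : V t *ᵥ c = exp (t • B) *ᵥ (V 0 *ᵥ (C *ᵥ c)) := by
    simp only [mulVec_mulVec, hC]
  have key := linear_flow_bot_le hrn hL11 hL22 hL12 hblock hgap hl hk0 hk h1 h2 h12
    (V 0 *ᵥ (C *ᵥ c)) (h0 _) ht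
  rw [← hw] at key
  have hsplit := star_dotProduct_self_re_eq_add hrn (V t *ᵥ c)
  rw [star_mulVec_dotProduct_mulVec_of_isometry (Matrix.oja_conjTranspose_mul_self hV hV0 ht)]
    at hsplit
  have hc1 : (star c ⬝ᵥ c).re = 1 := by simp [hc]
  have hbot := star_dotProduct_self_re_nonneg ((V t *ᵥ c) ∘ embBot (r := r))
  calc ‖V t (embBot i) j‖ ^ 2 = ‖((V t *ᵥ c) ∘ embBot (r := r)) i‖ ^ 2 := by simp [hc]
    _ ≤ (star ((V t *ᵥ c) ∘ embBot (r := r)) ⬝ᵥ ((V t *ᵥ c) ∘ embBot (r := r))).re := by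
      rw [star_dotProduct_self_re_eq_sum]
      exact Finset.single_le_sum
        (f := fun i => ‖((V t *ᵥ c) ∘ embBot (r := r)) i‖ ^ 2)
        (fun _ _ => sq_nonneg _) (Finset.mem_univ i)
    _ ≤ _ := key
    _ ≤ _ := mul_le_of_le_one_right (by positivity) (by linarith)

theorem exists_ratio_bound {δ l β ε : ℝ} (hδ : 0 < δ) (hl : 0 ≤ l) (hε : 0 < ε)
    (hβ : β = δ ^ 2 / (δ ^ 2 + 4 * l)) :
    ∃ k, 0 ≤ k ∧ 4 * l * k < δ ^ 2 ∧ ∀ a b : ℝ, 0 ≤ a → 0 ≤ b →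
      b ≤ (β - ε) * (a + b) → b ≤ k * a := by
  have hδ2 : 0 < δ ^ 2 := by positivity
  have hD : 0 < δ ^ 2 + 4 * l := by positivity
  have hβ0 : 0 < β := by rw [hβ]; positivity
  have hβ1 : β ≤ 1 := by rw [hβ, div_le_one hD]; linarith
  have hβD : β * (δ ^ 2 + 4 * l) = δ ^ 2 := by rw [hβ]; field_simp
  set γ := max (β - ε) 0 with hγ
  have hγβ : γ < β := max_lt (by linarith) hβ0
  have hγ0 : 0 ≤ γ := le_max_right _ _
  have hγ1 : 0 < 1 - γ := by linarith
  refine ⟨γ / (1 - γ), by positivity, ?_, fun a b ha hb hab => ?_⟩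
  · rw [mul_div_assoc', div_lt_iff₀ hγ1]
    nlinarith [mul_lt_mul_of_pos_right hγβ hD]
  · rw [div_mul_eq_mul_div, le_div_iff₀ hγ1]
    nlinarith [mul_le_mul_of_nonneg_right (le_max_left (β - ε) 0) (add_nonneg ha hb)]

/-- **Theorem 2 (domain of attraction of the Oja flow).**
Let `SᴴAS` be block upper triangular with diagonal blocks `L₁₁ ∈ ℂ^{r×r}`,
`L₂₂ ∈ ℂ^{(n−r)×(n−r)}` and off-diagonal block `L₁₂`.  Let
`δλ = λ_min(L₁₁+L₁₁ᴴ) − λ_max(L₂₂+L₂₂ᴴ) > 0`, let `ℓ_max` be the largest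
eigenvalue of `L₁₂ᴴL₁₂`, and `β = δλ²/(δλ² + 4ℓ_max)`.  If `U` solves the Oja
flow on the Stiefel manifold and the bottom block `F₂` of `SᴴU` satisfies
`F₂(0)ᴴF₂(0) < β I_r`, then `F₂(t) → 0` as `t → ∞`, i.e. `U(t)` converges to
the stable equilibrium set. -/
theorem oja_flow_domain_of_attraction
    {n r : ℕ} (hr : 0 < r) (hrn : r < n)
    (A : Matrix (Fin n) (Fin n) ℝ)
    (S : Matrix (Fin n) (Fin n) ℂ) (hS : S ∈ Matrix.unitaryGroup (Fin n) ℂ)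
    (L11 : Matrix (Fin r) (Fin r) ℂ)
    (L22 : Matrix (Fin (n - r)) (Fin (n - r)) ℂ)
    (L12 : Matrix (Fin r) (Fin (n - r)) ℂ)
    (hL11 : L11 = (Sᴴ * A.map Complex.ofReal * S).submatrix (embTop hrn.le) (embTop hrn.le))
    (hL22 : L22 = (Sᴴ * A.map Complex.ofReal * S).submatrix embBot embBot)
    (hL12 : L12 = (Sᴴ * A.map Complex.ofReal * S).submatrix (embTop hrn.le) embBot)
    (hblock : ∀ (i : Fin (n - r)) (j : Fin r),
      (Sᴴ * A.map Complex.ofReal * S) (embBot i) (embTop hrn.le j) = 0)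
    (lmin1 lmax2 lmax12 : ℝ)
    (hlmin1 : IsLeast {x : ℝ | (x : ℂ) ∈ spectrum ℂ (L11 + L11ᴴ)} lmin1)
    (hlmax2 : IsGreatest {x : ℝ | (x : ℂ) ∈ spectrum ℂ (L22 + L22ᴴ)} lmax2)
    (hlmax12 : IsGreatest {x : ℝ | (x : ℂ) ∈ spectrum ℂ (L12ᴴ * L12)} lmax12)
    (hgap : lmax2 < lmin1)
    (β : ℝ)
    (hβ : β = (lmin1 - lmax2) ^ 2 / ((lmin1 - lmax2) ^ 2 + 4 * lmax12))
    (U : ℝ → Matrix (Fin n) (Fin r) ℝ)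
    (hode : ∀ t : ℝ, 0 ≤ t → ∀ (i : Fin n) (j : Fin r),
      HasDerivAt (fun s : ℝ => U s i j)
        ((((1 : Matrix (Fin n) (Fin n) ℝ) - U t * (U t)ᵀ) * A * U t) i j) t)
    (hinit : (U 0)ᵀ * U 0 = (1 : Matrix (Fin r) (Fin r) ℝ))
    (F2 : ℝ → Matrix (Fin (n - r)) (Fin r) ℂ)
    (hF2 : ∀ t : ℝ, F2 t = (Sᴴ * (U t).map Complex.ofReal).submatrix embBot id)
    (hdom : ((β : ℂ) • (1 : Matrix (Fin r) (Fin r) ℂ) - (F2 0)ᴴ * F2 0).PosDef) :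
    Tendsto F2 atTop (nhds 0) := by
  set B := Sᴴ * A.map Complex.ofReal * S with hB
  set V : ℝ → Matrix (Fin n) (Fin r) ℂ := fun t => Sᴴ * (U t).map Complex.ofReal with hVdef
  have hSS : S * Sᴴ = 1 := Matrix.mem_unitaryGroup_iff.mp hS
  have hV : ∀ t, 0 ≤ t → HasDerivAt V ((1 - V t * (V t)ᴴ) * B * V t) t := fun t ht =>
    hasDerivAt_unitary_oja hSS (hode t ht)
  have hV0 : (V 0)ᴴ * V 0 = 1 := by
    rw [hVdef, conjTranspose_mul, conjTranspose_conjTranspose, Matrix.mul_assoc,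
      ← Matrix.mul_assoc S, hSS, Matrix.one_mul, ← map_ofReal_transpose, ← map_ofReal_mul, hinit]
    exact Matrix.map_one _ Complex.ofReal_zero Complex.ofReal_one
  have h1 := (isHermitian_add_transpose_self L11).mul_re_le_of_spectrum (c := lmin1)
    fun x hx => hlmin1.2 hx
  have h2 := (isHermitian_add_transpose_self L22).re_le_mul_of_spectrum (c := lmax2)
    fun x hx => hlmax2.2 hx
  have h12 := (isHermitian_conjTranspose_mul_self L12).re_le_mul_of_spectrum (c := lmax12)
    fun x hx => hlmax12.2 hx
  have hl : 0 ≤ lmax12 := by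
    have h := h12 (Pi.single ⟨0, by omega⟩ 1)
    rw [star_dotProduct_conjTranspose_mul_self_mulVec] at h
    have h' := (star_dotProduct_self_re_nonneg _).trans h
    simpa using h'
  obtain ⟨ε, hε, hεv⟩ := hdom.exists_mul_re_le
  obtain ⟨k, hk0, hk, hkab⟩ := exists_ratio_bound (sub_pos.mpr hgap) hl hε hβ
  have hF2V : ∀ t v, F2 t *ᵥ v = (V t *ᵥ v) ∘ embBot (r := r) := fun t v => by
    rw [hF2]
    rfl
  have h0 : ∀ v, (star ((V 0 *ᵥ v) ∘ embBot (r := r)) ⬝ᵥ ((V 0 *ᵥ v) ∘ embBot (r := r))).re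
      ≤ k * (star ((V 0 *ᵥ v) ∘ embTop hrn.le) ⬝ᵥ ((V 0 *ᵥ v) ∘ embTop hrn.le)).re := by
    intro v
    refine hkab _ _ (star_dotProduct_self_re_nonneg _) (star_dotProduct_self_re_nonneg _) ?_
    rw [← star_dotProduct_self_re_eq_add hrn.le, star_mulVec_dotProduct_mulVec_of_isometry hV0]
    have h := hεv v
    rw [sub_mulVec, dotProduct_sub, star_dotProduct_conjTranspose_mul_self_mulVec, smul_mulVec,
      one_mulVec, dotProduct_smul, smul_eq_mul, Complex.sub_re, Complex.re_ofReal_mul, hF2V] at h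
    linarith
  refine tendsto_pi_nhds.mpr fun i => tendsto_pi_nhds.mpr fun j => ?_
  set μ := ((lmin1 - lmax2) ^ 2 - 4 * lmax12 * k) / (2 * (lmin1 - lmax2)) with hμ
  have hμ0 : 0 < μ := div_pos (by linarith) (by linarith)
  have hlim : Tendsto (fun t => k * Real.exp (-(μ * t))) atTop (nhds 0) := by
    simpa using (Real.tendsto_exp_neg_atTop_nhds_zero.comp
      (tendsto_id.const_mul_atTop hμ0)).const_mul k
  have hsq : Tendsto (fun t => ‖F2 t i j‖ ^ 2) atTop (nhds 0) := by
    refine squeeze_zero' (Eventually.of_forall fun _ => sq_nonneg _) ?_ hlim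
    filter_upwards [eventually_ge_atTop 0] with t ht
    rw [hF2]
    exact oja_bot_norm_sq_le hrn.le hL11 hL22 hL12 hblock hgap hl hk0 hk h1 h2 h12 hV hV0 h0 ht i j
  have hsqrt := hsq.sqrt
  simp only [Real.sqrt_sq (norm_nonneg _), Real.sqrt_zero] at hsqrt
  exact tendsto_zero_iff_norm_tendsto_zero.mpr hsqrt
end

section
/- Let a > 0 and b > 0 be real numbers and let Z : [0,∞) → ℂ^{r×r} be a differentiable Hermitian-matrix-valued solution of the Riccati differential equation Z'(t) = −a Z(t) + b Z(t)², with initial condition satisfying 0 ≤ Z(0) < (a/b)·I_r in the Loewner order. Then Z(t) → O as t → ∞. -/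
open Matrix Filter
open scoped ComplexOrder

section LinearODE

attribute [local instance] Matrix.linftyOpNormedRing Matrix.linftyOpNormedAlgebra

/-- A solution of the homogeneous linear matrix equation `W' = A W` with continuous coefficient
and `W 0 = 0` vanishes on `[0, ∞)`. -/
theorem Matrix.eq_zero_of_hasDerivAt_mul_self {n : Type*} [Fintype n] [DecidableEq n]
    {A W : ℝ → Matrix n n ℂ} (hA : ContinuousOn A (Set.Ici 0))
    (hW : ∀ t : ℝ, 0 ≤ t → ∀ i j, HasDerivAt (fun s => W s i j) ((A t * W t) i j) t)
    (h0 : W 0 = 0) {t : ℝ} (ht : 0 ≤ t) : W t = 0 := by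
  have hW' : ∀ s : ℝ, 0 ≤ s → HasDerivAt W (A s * W s) s := fun s hs =>
    hasDerivAt_pi.2 fun i => hasDerivAt_pi.2 fun j => hW s hs i j
  obtain ⟨K, hK⟩ := isCompact_Icc.exists_bound_of_continuousOn
    (hA.mono (Set.Icc_subset_Ici_self : Set.Icc 0 t ⊆ Set.Ici 0))
  refine eq_zero_of_abs_deriv_le_mul_abs_self_of_eq_zero_right (f := W)
    (f' := fun s => A s * W s) (K := K) (a := 0) (b := t)
    (fun s hs => (hW' s hs.1).continuousAt.continuousWithinAt)
    (fun s hs => (hW' s hs.1).hasDerivWithinAt) h0 (fun s hs => ?_) t ⟨ht, le_rfl⟩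
  exact (norm_mul_le _ _).trans
    (mul_le_mul_of_nonneg_right (hK s ⟨hs.1, hs.2.le⟩) (norm_nonneg _))

end LinearODE

/-- A right product with a matrix function converging to an invertible matrix tends to zero
only if the left factor does. -/
theorem Matrix.tendsto_zero_of_tendsto_mul_zero {ι n : Type*} [Fintype n] [DecidableEq n]
    {l : Filter ι} {Z M : ι → Matrix n n ℂ} {N : Matrix n n ℂ} (hN : IsUnit N.det)
    (hM : Tendsto M l (nhds N)) (hZM : Tendsto (fun t => Z t * M t) l (nhds 0)) :
    Tendsto Z l (nhds 0) := by
  have hdet : Tendsto (fun t => (M t).det) l (nhds N.det) :=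
    ((continuous_id.matrix_det).tendsto N).comp hM
  have hadj : Tendsto (fun t => (M t).adjugate) l (nhds N.adjugate) :=
    ((continuous_id.matrix_adjugate).tendsto N).comp hM
  have hlim := (hdet.inv₀ hN.ne_zero).smul (hZM.mul hadj)
  rw [zero_mul, smul_zero] at hlim
  refine hlim.congr' ?_
  filter_upwards [hdet.eventually_ne hN.ne_zero] with t ht
  rw [mul_assoc, Matrix.mul_adjugate, mul_smul_comm, mul_one, smul_smul, inv_mul_cancel₀ ht,
    one_smul]

/-- Linearization of the matrix Riccati equation `Z' = -aZ + bZ²`. -/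
theorem Matrix.riccati_mul_eq {n : Type*} [Fintype n] [DecidableEq n] {a b : ℝ} (ha : a ≠ 0)
    {Z : ℝ → Matrix n n ℂ}
    (hode : ∀ t : ℝ, 0 ≤ t → ∀ i j, HasDerivAt (fun s : ℝ => Z s i j)
      (((-(a : ℂ)) • Z t + (b : ℂ) • (Z t * Z t)) i j) t)
    {t : ℝ} (ht : 0 ≤ t) :
    Z t * (1 - ((b / a * (1 - Real.exp (-a * t)) : ℝ) : ℂ) • Z 0) =
      ((Real.exp (-a * t) : ℝ) : ℂ) • Z 0 := by
  rw [← sub_eq_zero]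
  refine Matrix.eq_zero_of_hasDerivAt_mul_self
    (A := fun s => (-(a : ℂ)) • 1 + (b : ℂ) • Z s)
    (W := fun s => Z s * (1 - ((b / a * (1 - Real.exp (-a * s)) : ℝ) : ℂ) • Z 0) -
      ((Real.exp (-a * s) : ℝ) : ℂ) • Z 0) ?_ ?_ (by simp) ht
  · have hZ : ContinuousOn Z (Set.Ici 0) := continuousOn_pi.2 fun i => continuousOn_pi.2 fun j =>
      fun s hs => (hode s hs i j).continuousAt.continuousWithinAt
    fun_prop
  · intro s hs i j
    have hexp : HasDerivAt (fun u : ℝ => Real.exp (-a * u)) (-a * Real.exp (-a * s)) s := by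
      simpa [mul_comm] using ((hasDerivAt_id s).const_mul (-a)).exp
    have hcoef : HasDerivAt (fun u : ℝ => b / a * (1 - Real.exp (-a * u)))
        (b * Real.exp (-a * s)) s := by
      refine ((hexp.const_sub 1).const_mul (b / a)).congr_deriv ?_
      field_simp
    have hM : ∀ k, HasDerivAt (fun u : ℝ =>
        (1 - ((b / a * (1 - Real.exp (-a * u)) : ℝ) : ℂ) • Z 0) k j)
        (-(((b * Real.exp (-a * s) : ℝ) : ℂ) * Z 0 k j)) s := fun k =>
      (hcoef.ofReal_comp.mul_const (Z 0 k j)).const_sub _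
    have hmul := (HasDerivAt.fun_sum (u := Finset.univ) fun k _ =>
      (hode s hs i k).mul (hM k)).sub (hexp.ofReal_comp.mul_const (Z 0 i j))
    refine hmul.congr_deriv ?_
    rw [Finset.sum_add_distrib]
    set M := (1 : Matrix n n ℂ) - ((b / a * (1 - Real.exp (-a * s)) : ℝ) : ℂ) • Z 0 with hMdef
    set e := Real.exp (-a * s)
    have key : ((-(a : ℂ)) • 1 + (b : ℂ) • Z s) * (Z s * M - (e : ℂ) • Z 0) =
        ((-(a : ℂ)) • Z s + (b : ℂ) • (Z s * Z s)) * M +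
          Z s * (-(((b * e : ℝ) : ℂ) • Z 0)) - ((-a * e : ℝ) : ℂ) • Z 0 := by
      simp only [add_mul, mul_sub, smul_mul_assoc, mul_smul_comm, one_mul, mul_neg, mul_assoc]
      push_cast
      module
    exact (congrFun (congrFun key i) j).symm

/-- **Convergence of the scalar-coefficient Riccati comparison equation.**
For `a, b > 0`, any Hermitian solution of `Z' = −aZ + bZ²` with
`0 ≤ Z(0) < (a/b) I_r` converges to the zero matrix. -/
theorem riccati_comparison_convergence
    {r : ℕ} (a b : ℝ) (ha : 0 < a) (hb : 0 < b)
    (Z : ℝ → Matrix (Fin r) (Fin r) ℂ)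
    (hherm : ∀ t : ℝ, 0 ≤ t → (Z t).IsHermitian)
    (hode : ∀ t : ℝ, 0 ≤ t → ∀ (i j : Fin r),
      HasDerivAt (fun s : ℝ => Z s i j)
        (((-(a : ℂ)) • Z t + (b : ℂ) • (Z t * Z t)) i j) t)
    (hinit0 : (Z 0).PosSemidef)
    (hinit1 : (((a / b : ℝ) : ℂ) • (1 : Matrix (Fin r) (Fin r) ℂ) - Z 0).PosDef) :
    Tendsto Z atTop (nhds 0) := by
  have hexp : Tendsto (fun t : ℝ => Real.exp (-a * t)) atTop (nhds 0) :=
    Real.tendsto_exp_atBot.comp (tendsto_id.const_mul_atTop_of_neg (neg_lt_zero.2 ha))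
  have hunit : IsUnit ((1 : Matrix (Fin r) (Fin r) ℂ) - ((b / a : ℝ) : ℂ) • Z 0).det := by
    have hscale : (1 : Matrix (Fin r) (Fin r) ℂ) - ((b / a : ℝ) : ℂ) • Z 0 =
        ((b / a : ℝ) : ℂ) • (((a / b : ℝ) : ℂ) • (1 : Matrix (Fin r) (Fin r) ℂ) - Z 0) := by
      rw [smul_sub, smul_smul, ← Complex.ofReal_mul, div_mul_div_cancel₀ ha.ne', div_self hb.ne',
        Complex.ofReal_one, one_smul]
    rw [hscale, Matrix.det_smul]
    exact (mul_ne_zero (pow_ne_zero _ (Complex.ofReal_ne_zero.2 (div_pos hb ha).ne'))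
      hinit1.det_pos.ne').isUnit
  refine Matrix.tendsto_zero_of_tendsto_mul_zero hunit
    (M := fun t => 1 - ((b / a * (1 - Real.exp (-a * t)) : ℝ) : ℂ) • Z 0) ?_ ?_
  · have hcoef := (hexp.const_sub 1).const_mul (b / a)
    rw [sub_zero, mul_one] at hcoef
    exact (hcoef.ofReal.smul_const (Z 0)).const_sub 1
  · have hlim := hexp.ofReal.smul_const (Z 0)
    rw [Complex.ofReal_zero, zero_smul] at hlim
    refine hlim.congr' ?_
    filter_upwards [eventually_ge_atTop 0] with t ht
    exact (Matrix.riccati_mul_eq ha.ne' hode ht).symm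
end

section
/- Let A ∈ ℝ^{n×n}, C ∈ ℝ^{p×n}, M ∈ ℝ^{p×p}, and R̃ ∈ ℝ^{r×r}. Let Ū ∈ ℝ^{n×r} satisfy ŪᵀŪ = I_r and ŪŪᵀAŪ = AŪ. Then the following identity of characteristic polynomials over ℝ holds: charpoly(A − Ū R̃ Ūᵀ Cᵀ M C) · charpoly(ŪᵀAŪ) = charpoly(A) · charpoly(ŪᵀAŪ − R̃ (CŪ)ᵀ M (CŪ)). In particular, the multiset of eigenvalues of A − Ū R̃ Ūᵀ Cᵀ M C consists of the r eigenvalues of ŪᵀAŪ − R̃ (CŪ)ᵀ M (CŪ) together with the n − r eigenvalues of A that remain after removing the eigenvalues of ŪᵀAŪ. -/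
open Matrix

/-- If `X * U = U * Y`, the determinants of the perturbations `X + U * K` and `Y + K * U` are
related without any invertibility assumption. -/
theorem det_add_mul_mul_det_of_intertwine {R m k : Type*} [CommRing R]
    [Fintype m] [DecidableEq m] [Fintype k] [DecidableEq k]
    {X : Matrix m m R} {Y : Matrix k k R} {U : Matrix m k R} (K : Matrix k m R)
    (h : X * U = U * Y) :
    (X + U * K).det * Y.det = X.det * (Y + K * U).det := by
  have hblock : fromBlocks X (-U) K 1 * fromBlocks 1 U 0 Y = fromBlocks X 0 K (Y + K * U) := by
    simp [fromBlocks_multiply, h, add_comm]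
  simpa [det_mul, det_fromBlocks_one₂₂] using congrArg det hblock

/-- If `A * U = U * B`, the characteristic polynomials of the perturbations `A - U * K` and
`B - K * U` are related to those of `A` and `B`. -/
theorem charpoly_sub_mul_mul_charpoly_of_intertwine {R m k : Type*} [CommRing R]
    [Fintype m] [DecidableEq m] [Fintype k] [DecidableEq k]
    {A : Matrix m m R} {B : Matrix k k R} {U : Matrix m k R} (K : Matrix k m R)
    (h : A * U = U * B) :
    (A - U * K).charpoly * B.charpoly = A.charpoly * (B - K * U).charpoly := by
  have hX : charmatrix A * U.map Polynomial.C = U.map Polynomial.C * charmatrix B := by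
    have hmap : A.map Polynomial.C * U.map Polynomial.C
        = U.map Polynomial.C * B.map Polynomial.C := by
      rw [← Matrix.map_mul, ← Matrix.map_mul, h]
    simp only [charmatrix, RingHom.mapMatrix_apply, Matrix.sub_mul, Matrix.mul_sub, hmap]
    congr 1
    ext i j
    rw [Matrix.scalar_apply, Matrix.scalar_apply, diagonal_mul, mul_diagonal, mul_comm]
  have hA : charmatrix (A - U * K)
      = charmatrix A + U.map Polynomial.C * K.map Polynomial.C := by
    rw [← Matrix.map_mul]
    simp only [charmatrix, map_sub, RingHom.mapMatrix_apply]
    abel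
  have hB : charmatrix (B - K * U)
      = charmatrix B + K.map Polynomial.C * U.map Polynomial.C := by
    rw [← Matrix.map_mul]
    simp only [charmatrix, map_sub, RingHom.mapMatrix_apply]
    abel
  simp only [charpoly, hA, hB]
  exact det_add_mul_mul_det_of_intertwine _ hX

/-- **Proposition 7 (eigenvalues of the closed-loop matrix).**
If `Ū` is an equilibrium point of the Oja flow (`ŪᵀŪ = I_r`, `ŪŪᵀAŪ = AŪ`),
then for any `R̃ ∈ ℝ^{r×r}` and any `M ∈ ℝ^{p×p}` the characteristic
polynomials satisfy
`charpoly(A − ŪR̃ŪᵀCᵀMC) · charpoly(ŪᵀAŪ)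
  = charpoly(A) · charpoly(ŪᵀAŪ − R̃(CŪ)ᵀM(CŪ))`,
so the eigenvalues of the closed-loop matrix are those of the reduced
closed-loop matrix together with the remaining `n − r` eigenvalues of `A`. -/
theorem closedloop_charpoly_identity
    {n r p : ℕ} (hrn : r ≤ n)
    (A : Matrix (Fin n) (Fin n) ℝ) (C : Matrix (Fin p) (Fin n) ℝ)
    (M : Matrix (Fin p) (Fin p) ℝ)
    (Rt : Matrix (Fin r) (Fin r) ℝ)
    (Ubar : Matrix (Fin n) (Fin r) ℝ)
    (hU : Ubarᵀ * Ubar = (1 : Matrix (Fin r) (Fin r) ℝ))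
    (heq : Ubar * Ubarᵀ * A * Ubar = A * Ubar) :
    (A - Ubar * Rt * Ubarᵀ * Cᵀ * M * C).charpoly * (Ubarᵀ * A * Ubar).charpoly
      = A.charpoly
        * (Ubarᵀ * A * Ubar - Rt * (C * Ubar)ᵀ * M * (C * Ubar)).charpoly := by
  have hAU : A * Ubar = Ubar * (Ubarᵀ * A * Ubar) := by
    rw [← heq]
    simp only [Matrix.mul_assoc]
  have hmain := charpoly_sub_mul_mul_charpoly_of_intertwine (Rt * Ubarᵀ * Cᵀ * M * C) hAU
  simpa only [Matrix.transpose_mul, Matrix.mul_assoc] using hmain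
end

section
/- Let A ∈ ℝ^{n×n}, C ∈ ℝ^{p×n}, M ∈ ℝ^{p×p}, and let Ū ∈ ℝ^{n×r} satisfy ŪᵀŪ = I_r and ŪŪᵀAŪ = AŪ. Suppose: (i) the multiset of complex eigenvalues of ŪᵀAŪ equals the multiset of the r eigenvalues of A with the largest real parts, and Re(λ_r(A)) > Re(λ_{r+1}(A)) where λ₁(A),…,λ_n(A) are the eigenvalues of A ordered by decreasing real part; (ii) R̃ ∈ ℝ^{r×r} is such that every complex eigenvalue of ŪᵀAŪ − R̃ (CŪ)ᵀ M (CŪ) has strictly negative real part. Let r' be the number of eigenvalues of A (counted with algebraic multiplicity) having nonnegative real part. Then every complex eigenvalue of A − Ū R̃ Ūᵀ Cᵀ M C has strictly negative real part if and only if r ≥ r'. -/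
open Matrix

/-- If the range of `U` is `A`-invariant, with `A * U = U * B`, then perturbing `A` by the
feedback `U * K` only changes the part of the spectrum carried by `B`. -/
theorem charpoly_sub_mul_mul_charpoly {R m k : Type*} [CommRing R] [Fintype m] [DecidableEq m]
    [Fintype k] [DecidableEq k] (A : Matrix m m R) (U : Matrix m k R) (K : Matrix k m R)
    (B : Matrix k k R) (h : A * U = U * B) :
    (A - U * K).charpoly * B.charpoly = A.charpoly * (B - K * U).charpoly := by
  let f : R →+* Polynomial R := Polynomial.C
  have hf : A.map f * U.map f = U.map f * B.map f := by
    rw [← Matrix.map_mul, h, Matrix.map_mul]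
  have e : fromBlocks A.charmatrix (U.map f) (-K.map f) 1 *
      fromBlocks 1 (-U.map f) 0 B.charmatrix =
      fromBlocks A.charmatrix 0 (-K.map f) (B - K * U).charmatrix := by
    rw [fromBlocks_multiply]
    have hs : scalar m (Polynomial.X : Polynomial R) * U.map f =
        U.map f * scalar k (Polynomial.X : Polynomial R) := by
      ext i j
      simp [mul_comm]
    congr 1
    · simp
    · simp only [charmatrix, RingHom.mapMatrix_apply]
      change _ = (0 : Matrix m k (Polynomial R))
      rw [Matrix.mul_neg, Matrix.sub_mul, Matrix.mul_sub, hs]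
      change -(_ - A.map f * U.map f) + (_ - U.map f * B.map f) = 0
      rw [hf]
      abel
    · simp
    · simp only [charmatrix, map_sub, RingHom.mapMatrix_apply, Matrix.map_mul, Matrix.neg_mul,
        Matrix.mul_neg, neg_neg, Matrix.one_mul]
      change K.map f * U.map f + _ = _ - (_ - K.map f * U.map f)
      abel
  have d := congrArg det e
  rw [det_mul, det_fromBlocks_one₂₂, det_fromBlocks_zero₂₁, det_fromBlocks_zero₁₂, det_one,
    one_mul] at d
  rw [charpoly, charpoly, charpoly, charpoly, ← d]
  congr 2
  simp only [charmatrix, map_sub, RingHom.mapMatrix_apply, Matrix.map_mul, Matrix.mul_neg]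
  change _ - (_ - U.map f * K.map f) = _
  abel

/-- Splitting a family indexed by `Fin n` into its first `r` terms and the remaining ones. -/
theorem map_univ_eq_map_castLE_add {α : Type*} {n r : ℕ} (h : r ≤ n) (g : Fin n → α) :
    Multiset.map g Finset.univ.val =
      Multiset.map (fun i : Fin r => g (Fin.castLE h i)) Finset.univ.val +
        Multiset.map g (Finset.univ.filter fun i : Fin n => r ≤ i.val).val := by
  obtain ⟨m, rfl⟩ := Nat.exists_eq_add_of_le h
  have e : (Finset.univ.filter fun i : Fin (r + m) => ¬ r ≤ i.val) =
      Finset.univ.map (Fin.castLEEmb h) := by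
    ext i
    simp only [Finset.mem_filter, Finset.mem_univ, true_and, Finset.mem_map, not_le]
    exact ⟨fun hi => ⟨⟨i, hi⟩, rfl⟩, by rintro ⟨j, rfl⟩; exact j.2⟩
  rw [← Multiset.filter_add_not (fun i : Fin (r + m) => r ≤ i.val) Finset.univ.val,
    ← Finset.filter_val, ← Finset.filter_val, e, Multiset.map_add, add_comm, Finset.map_val,
    Multiset.map_map]
  rfl

/-- For a nonincreasing family, at most the first `r` terms are nonnegative iff all the
later terms are negative. -/
theorem card_filter_nonneg_le_iff {n r : ℕ} (g : Fin n → ℝ)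
    (hg : ∀ i j : Fin n, i ≤ j → g j ≤ g i) :
    (Finset.univ.filter fun i => 0 ≤ g i).card ≤ r ↔ ∀ i : Fin n, r ≤ i.val → g i < 0 := by
  constructor
  · intro hc i hi
    by_contra! h0
    have hs : Finset.Iic i ⊆ Finset.univ.filter fun i => 0 ≤ g i := fun j hj => by
      simpa using h0.trans (hg j i (Finset.mem_Iic.1 hj))
    have := Finset.card_le_card hs
    rw [Fin.card_Iic] at this
    omega
  · intro h
    have hm : ∀ i ∈ Finset.univ.filter fun i => 0 ≤ g i, i.val ∈ Finset.range r := fun i hi => by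
      by_contra hlt
      have := h i (by simpa using hlt)
      have := (Finset.mem_filter.1 hi).2
      linarith
    simpa using Finset.card_le_card_of_injOn (fun i : Fin n => i.val) hm
      Fin.val_injective.injOn

/-- **Theorem 3 (rank condition for a stable closed loop).**
Let `Ū` be an equilibrium point of the Oja flow whose reduced matrix `ŪᵀAŪ`
carries exactly the `r` eigenvalues of `A` of largest real part (with a gap
`Re λ_r(A) > Re λ_{r+1}(A)`), and suppose the reduced closed-loop matrix
`ŪᵀAŪ − R̃(CŪ)ᵀM(CŪ)` is stable.  Let `r'` be the number of eigenvalues of `A`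
with nonnegative real part.  Then the closed-loop matrix
`A − ŪR̃ŪᵀCᵀMC` is stable iff `r ≥ r'`. -/
theorem lowrank_filter_rank_condition
    {n r p : ℕ} (hr : 0 < r) (hrn : r < n)
    (A : Matrix (Fin n) (Fin n) ℝ) (C : Matrix (Fin p) (Fin n) ℝ)
    (M : Matrix (Fin p) (Fin p) ℝ)
    (Rt : Matrix (Fin r) (Fin r) ℝ)
    (Ubar : Matrix (Fin n) (Fin r) ℝ)
    (hU : Ubarᵀ * Ubar = (1 : Matrix (Fin r) (Fin r) ℝ))
    (heq : Ubar * Ubarᵀ * A * Ubar = A * Ubar)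
    (lam : Fin n → ℂ)
    (hroots : (A.map Complex.ofReal).charpoly.roots
      = Multiset.map lam Finset.univ.val)
    (horder : ∀ i j : Fin n, i ≤ j → (lam j).re ≤ (lam i).re)
    (hgap : (lam ⟨r, hrn⟩).re < (lam ⟨r - 1, by omega⟩).re)
    (hUspec : ((Ubarᵀ * A * Ubar).map Complex.ofReal).charpoly.roots
      = Multiset.map (fun i : Fin r => lam (Fin.castLE hrn.le i)) Finset.univ.val)
    (hred : ∀ μ ∈ (((Ubarᵀ * A * Ubar)
        - Rt * (C * Ubar)ᵀ * M * (C * Ubar)).map Complex.ofReal).charpoly.roots,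
      μ.re < 0)
    (r' : ℕ)
    (hr' : r' = Multiset.card
      (Multiset.filter (fun μ : ℂ => 0 ≤ μ.re) (A.map Complex.ofReal).charpoly.roots)) :
    (∀ μ ∈ ((A - Ubar * Rt * Ubarᵀ * Cᵀ * M * C).map Complex.ofReal).charpoly.roots,
      μ.re < 0) ↔ r' ≤ r := by
  set K : Matrix (Fin r) (Fin n) ℝ := Rt * (C * Ubar)ᵀ * M * C with hK
  have hcl : A - Ubar * Rt * Ubarᵀ * Cᵀ * M * C = A - Ubar * K := by
    simp only [hK, transpose_mul, Matrix.mul_assoc]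
  have hre : Ubarᵀ * A * Ubar - Rt * (C * Ubar)ᵀ * M * (C * Ubar) =
      Ubarᵀ * A * Ubar - K * Ubar := by
    simp only [hK, Matrix.mul_assoc]
  have hinv : A * Ubar = Ubar * (Ubarᵀ * A * Ubar) := by
    rw [← heq]
    simp only [Matrix.mul_assoc]
  have hmap : ∀ {k : ℕ} (X : Matrix (Fin k) (Fin k) ℝ),
      (X.map Complex.ofReal).charpoly = X.charpoly.map Complex.ofRealHom :=
    fun X => charpoly_map X Complex.ofRealHom
  have hmonic : ∀ {k : ℕ} (X : Matrix (Fin k) (Fin k) ℝ),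
      (X.map Complex.ofReal).charpoly ≠ 0 := fun X => (charpoly_monic _).ne_zero
  have hprod := congrArg (Polynomial.map Complex.ofRealHom)
    (charpoly_sub_mul_mul_charpoly A Ubar K _ hinv)
  rw [Polynomial.map_mul, Polynomial.map_mul, ← hmap, ← hmap, ← hmap, ← hmap] at hprod
  have hadd := congrArg Polynomial.roots hprod
  rw [Polynomial.roots_mul (mul_ne_zero (hmonic _) (hmonic _)),
    Polynomial.roots_mul (mul_ne_zero (hmonic _) (hmonic _)), hroots,
    map_univ_eq_map_castLE_add hrn.le lam, ← hUspec, add_assoc, add_comm, add_right_inj] at hadd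
  rw [hre] at hred
  rw [hr', hroots, Multiset.filter_map, Multiset.card_map, hcl, hadd]
  refine Iff.trans ?_ (card_filter_nonneg_le_iff (fun i => (lam i).re) horder).symm
  constructor
  · intro h i hi
    exact h _ (Multiset.mem_add.2 (Or.inl (Multiset.mem_map_of_mem lam (by simpa using hi))))
  · intro h μ hμ
    rcases Multiset.mem_add.1 hμ with hμ | hμ
    · obtain ⟨i, hi, rfl⟩ := Multiset.mem_map.1 hμ
      exact h i (by simpa using hi)
    · exact hred μ hμ
end
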